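/- arXiv:2211.10377 — 10 statements merged into one kernel-verified Lean document; each statement's English description precedes it below -/
import Mathlib

section
/- For all integers ℓ ≥ 2 and r ≥ 2 there exists a real number ε > 0 (depending on ℓ and r) such that D_r(m;ℓ) ≥ 2^{ε·m^{r-1}} holds for every integer m > r. -/
/-- The coloring `φ` of subsets of `[n]` admits a monochromatic `(r,m)`-daisy:
disjoint sets `K, M ⊆ [n]` with `|M| = m` such that `φ` is constant on
`{K ∪ P : P ⊆ M, |P| = r}`. -/
def HasMonoDaisy (n r m ℓ : ℕ) (φ : Finset ℕ → Fin ℓ) : Prop :=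
  ∃ K M : Finset ℕ, K ⊆ Finset.range n ∧ M ⊆ Finset.range n ∧ Disjoint K M ∧
    M.card = m ∧ ∃ c : Fin ℓ, ∀ P ⊆ M, P.card = r → φ (K ∪ P) = c

/-- `D_r(m;ℓ)`: the least `n` such that every `ℓ`-coloring of the subsets of `[n]`
admits a monochromatic `(r,m)`-daisy. -/
noncomputable def daisyRamsey (r m ℓ : ℕ) : ℕ :=
  sInf {n | ∀ φ : Finset ℕ → Fin ℓ, HasMonoDaisy n r m ℓ φ}


theorem ramsey_step (ℓ r : ℕ)
    (ih : ∀ m : ℕ, ∃ N : ℕ, ∀ X : Finset ℕ, N ≤ X.card → ∀ φ : Finset ℕ → Fin ℓ,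
      ∃ M ⊆ X, M.card = m ∧ ∃ c : Fin ℓ, ∀ P ⊆ M, P.card = r → φ P = c) (s : ℕ) :
    ∀ d : Fin ℓ → ℕ, ∑ c, d c ≤ s → 
      ∃ N : ℕ, ∀ X : Finset ℕ, N ≤ X.card → ∀ φ : Finset ℕ → Fin ℓ,
      ∃ c : Fin ℓ, ∃ M ⊆ X, M.card = d c ∧ ∀ P ⊆ M, P.card = r + 1 → φ P = c := by
  induction s with
  | zero =>
    intro d hd
    refine ⟨0, fun X _ φ => ⟨φ ∅, ∅, by simp, ?_, ?_⟩⟩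
    · have := Finset.single_le_sum (f := d) (fun i _ => Nat.zero_le _) (Finset.mem_univ (φ ∅))
      simp; omega
    · intro P hP hc
      have := Finset.card_le_card hP
      simp at this; simp [this] at hc
  | succ s hs =>
    intro d hd
    by_cases h0 : ∃ c, d c = 0
    · obtain ⟨c, hc⟩ := h0
      refine ⟨0, fun X _ φ => ⟨c, ∅, by simp, by simp [hc], ?_⟩⟩
      intro P hP hc
      have := Finset.card_le_card hP
      simp at this; simp [this] at hc
    · push Not at h0
      have key : ∀ c, ∃ N : ℕ, ∀ X : Finset ℕ, N ≤ X.card → ∀ φ : Finset ℕ → Fin ℓ,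
          ∃ c' : Fin ℓ, ∃ M ⊆ X, M.card = Function.update d c (d c - 1) c' ∧
            ∀ P ⊆ M, P.card = r + 1 → φ P = c' := by
        intro c
        apply hs
        have h1 := Finset.sum_update_of_mem (Finset.mem_univ c) d (d c - 1)
        have h2 := Finset.add_sum_erase _ d (Finset.mem_univ c)
        have h3 := h0 c
        rw [Finset.sdiff_singleton_eq_erase] at h1
        omega
      choose N hN using key
      obtain ⟨N', hN'⟩ := ih (∑ c, N c)
      refine ⟨N' + 1, fun X hX φ => ?_⟩
      obtain ⟨x, hx⟩ : X.Nonempty := Finset.card_pos.mp (by omega)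
      obtain ⟨Y, hY, hYc, c, hc⟩ := hN' (X.erase x) (by rw [Finset.card_erase_of_mem hx]; omega)
        (fun P => φ (insert x P))
      obtain ⟨c', M, hM, hMc, hP⟩ := hN c Y (by
        rw [hYc]; exact Finset.single_le_sum (f := N) (fun i _ => Nat.zero_le _) (Finset.mem_univ c)) φ
      have hxM : x ∉ M := fun h => by simpa using hY (hM h)
      by_cases hcc : c' = c
      · subst hcc
        refine ⟨c', insert x M, ?_, ?_, ?_⟩
        · intro y hy
          rcases Finset.mem_insert.mp hy with rfl | hy
          · exact hx
          · exact Finset.mem_of_mem_erase (hY (hM hy))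
        · rw [Finset.card_insert_of_notMem hxM, hMc]
          have := h0 c'
          simp; omega
        · intro P hPs hPc
          by_cases hxP : x ∈ P
          · have := hc (P.erase x) (fun y hy => hM ((Finset.mem_insert.mp
              (hPs (Finset.mem_of_mem_erase hy))).resolve_left (Finset.ne_of_mem_erase hy)))
              (by rw [Finset.card_erase_of_mem hxP]; omega)
            simpa [Finset.insert_erase hxP] using this
          · exact hP P ((Finset.subset_insert_iff_of_notMem hxP).mp hPs) hPc
      · refine ⟨c', M, fun y hy => Finset.mem_of_mem_erase (hY (hM hy)), ?_, hP⟩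
        rw [hMc, Function.update_of_ne hcc]

theorem ramsey_finite (ℓ r : ℕ) : ∀ m : ℕ, ∃ N : ℕ, ∀ X : Finset ℕ, N ≤ X.card →
    ∀ φ : Finset ℕ → Fin ℓ,
      ∃ M ⊆ X, M.card = m ∧ ∃ c : Fin ℓ, ∀ P ⊆ M, P.card = r → φ P = c := by
  induction r with
  | zero =>
    intro m
    refine ⟨m, fun X hX φ => ?_⟩
    obtain ⟨M, hM, hMc⟩ := Finset.exists_subset_card_eq hX
    refine ⟨M, hM, hMc, φ ∅, fun P _ hP => by rw [Finset.card_eq_zero.mp hP]⟩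
  | succ r ih =>
    intro m
    obtain ⟨N, hN⟩ := ramsey_step ℓ r ih _ (fun _ => m) le_rfl
    refine ⟨N, fun X hX φ => ?_⟩
    obtain ⟨c, M, h1, h2, h3⟩ := hN X hX φ
    exact ⟨M, h1, h2, c, h3⟩

/-- Decomposition of the degree `r` polynomial on the daisy. -/
theorem poly_decomp (r : ℕ) (g : Finset ℕ → ZMod 2) (K M P : Finset ℕ) (hKM : Disjoint K M)
    (hP : P ⊆ M) (hPr : P.card = r) :
    ∑ T ∈ (K ∪ P).powersetCard r, g T = g P +
      ∑ Q ∈ P.ssubsets, ∑ T ∈ ((K ∪ M).powersetCard r).filter (fun T => T ∩ M = Q), g T := by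
  have hmaps : ∀ T ∈ (K ∪ P).powersetCard r, T ∩ M ∈ P.powerset := by
    intro T hT
    rw [Finset.mem_powersetCard] at hT
    rw [Finset.mem_powerset]
    intro y hy
    rw [Finset.mem_inter] at hy
    rcases Finset.mem_union.mp (hT.1 hy.1) with h | h
    · exact absurd hy.2 (Finset.disjoint_left.mp hKM h)
    · exact h
  have hfib : ∀ Q ∈ P.powerset, ((K ∪ P).powersetCard r).filter (fun T => T ∩ M = Q)
      = ((K ∪ M).powersetCard r).filter (fun T => T ∩ M = Q) := by
    intro Q hQ
    rw [Finset.mem_powerset] at hQ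
    ext T
    simp only [Finset.mem_filter, Finset.mem_powersetCard]
    constructor
    · rintro ⟨⟨h1, h2⟩, h3⟩
      exact ⟨⟨h1.trans (Finset.union_subset_union_right hP), h2⟩, h3⟩
    · rintro ⟨⟨h1, h2⟩, h3⟩
      refine ⟨⟨fun y hy => ?_, h2⟩, h3⟩
      rcases Finset.mem_union.mp (h1 hy) with h | h
      · exact Finset.mem_union_left _ h
      · exact Finset.mem_union_right _ (hQ (h3 ▸ Finset.mem_inter.mpr ⟨hy, h⟩))
  rw [← Finset.sum_fiberwise_of_maps_to hmaps, Finset.sum_congr rfl (fun Q hQ => by rw [hfib Q hQ])]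
  rw [← Finset.add_sum_erase _ _ (Finset.mem_powerset_self P)]
  congr 1
  have : ((K ∪ M).powersetCard r).filter (fun T => T ∩ M = P) = {P} := by
    ext T
    simp only [Finset.mem_filter, Finset.mem_powersetCard, Finset.mem_singleton]
    constructor
    · rintro ⟨⟨h1, h2⟩, h3⟩
      symm
      apply Finset.eq_of_subset_of_card_le
      · rw [← h3]; exact Finset.inter_subset_left
      · omega
    · rintro rfl
      exact ⟨⟨hP.trans Finset.subset_union_right, hPr⟩, Finset.inter_eq_left.mpr hP⟩
  rw [this, Finset.sum_singleton]

/-- Number of small subsets. -/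
theorem card_small (r m : ℕ) (hm : 1 ≤ m) (M : Finset ℕ) (hM : M.card = m) :
    (M.powerset.filter (fun Q => Q.card < r)).card ≤ r * m ^ (r - 1) := by
  have : M.powerset.filter (fun Q => Q.card < r) ⊆
      (Finset.range r).biUnion (fun j => M.powersetCard j) := by
    intro Q hQ
    simp only [Finset.mem_filter, Finset.mem_powerset] at hQ
    simp [Finset.mem_powersetCard, hQ.1, hQ.2]
  refine (Finset.card_le_card this).trans ?_
  have := Finset.card_biUnion_le_card_mul (Finset.range r) (fun j => M.powersetCard j)
    (m ^ (r - 1)) (by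
      intro j hj
      rw [Finset.mem_range] at hj
      rw [Finset.card_powersetCard, hM]
      exact (Nat.choose_le_pow m j).trans (Nat.pow_le_pow_right hm (by omega)))
  simpa using this

/-- Prescribed-values count. -/
theorem card_prescribed {ι : Type*} [Fintype ι] [DecidableEq ι] (A : Finset ι) (v : ι → ZMod 2) :
    (Finset.univ.filter (fun g : ι → ZMod 2 => ∀ P ∈ A, g P = v P)).card * 2 ^ A.card
      = 2 ^ Fintype.card ι := by
  have : Finset.univ.filter (fun g : ι → ZMod 2 => ∀ P ∈ A, g P = v P)
      = Fintype.piFinset (fun P => if P ∈ A then {v P} else Finset.univ) := by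
    ext g
    simp only [Finset.mem_filter, Finset.mem_univ, true_and, Fintype.mem_piFinset]
    refine forall_congr' fun P => ?_
    by_cases h : P ∈ A <;> simp [h]
  rw [this, Fintype.card_piFinset]
  have h2 : ∀ P, (if P ∈ A then ({v P} : Finset (ZMod 2)) else Finset.univ).card
      = if P ∈ A then 1 else 2 := by
    intro P; by_cases h : P ∈ A <;> simp [h, ZMod.card]
  simp_rw [h2]
  rw [Finset.prod_ite]
  simp only [Finset.prod_const, one_pow, one_mul]
  rw [← pow_add, ← Finset.card_univ, ← Finset.card_filter_add_card_filter_not (s := Finset.univ) (fun P => P ∈ A)]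
  simp [add_comm]

theorem exists_good (n m r : ℕ) (hm : 1 ≤ m)
    (hlt : n ^ m * 2 ^ (r * m ^ (r - 1)) < 2 ^ (m.choose r)) :
    ∃ g : Finset ℕ → ZMod 2, ∀ M ⊆ Finset.range n, M.card = m → ∀ h : Finset ℕ → ZMod 2,
      ¬ ∀ P ⊆ M, P.card = r → g P = ∑ Q ∈ P.ssubsets, h Q := by
  classical
  by_contra hcon
  push Not at hcon
  let ι := {T : Finset ℕ // T ∈ (Finset.range n).powerset}
  let A : Finset ℕ → Finset ι := fun M => Finset.univ.filter (fun P => P.1 ⊆ M ∧ P.1.card = r)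
  let v : Finset (Finset ℕ) → ι → ZMod 2 :=
    fun H P => ∑ Q ∈ P.1.ssubsets, if Q ∈ H then 1 else 0
  let F : Finset ℕ → Finset (Finset ℕ) → Finset (ι → ZMod 2) :=
    fun M H => Finset.univ.filter (fun g => ∀ P ∈ A M, g P = v H P)
  let B : Finset ℕ → Finset (Finset ℕ) := fun M => M.powerset.filter (fun Q => Q.card < r)
  have hA : ∀ M ∈ (Finset.range n).powersetCard m, (A M).card = m.choose r := by
    intro M hM
    rw [Finset.mem_powersetCard] at hM
    rw [← hM.2, ← Finset.card_powersetCard]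
    apply Finset.card_bij (fun P _ => P.1)
    · intro P hP
      simpa [A, Finset.mem_powersetCard] using hP
    · intro P _ P' _ h
      exact Subtype.ext h
    · intro P hP
      rw [Finset.mem_powersetCard] at hP
      exact ⟨⟨P, Finset.mem_powerset.mpr (hP.1.trans hM.1)⟩, by simpa [A] using hP, rfl⟩
  have hcover : (Finset.univ : Finset (ι → ZMod 2)) ⊆
      ((Finset.range n).powersetCard m).biUnion (fun M => (B M).powerset.biUnion (F M)) := by
    intro g _
    obtain ⟨M, hM, hMc, h, hP⟩ := hcon (fun T => if hT : T ∈ (Finset.range n).powerset then g ⟨T, hT⟩ else 0)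
    simp only [Finset.mem_biUnion]
    refine ⟨M, Finset.mem_powersetCard.mpr ⟨hM, hMc⟩, (B M).filter (fun Q => h Q = 1),
      Finset.mem_powerset.mpr (Finset.filter_subset _ _), ?_⟩
    simp only [F, Finset.mem_filter, Finset.mem_univ, true_and]
    intro P hPA
    simp only [A, Finset.mem_filter, Finset.mem_univ, true_and] at hPA
    have := hP P.1 hPA.1 hPA.2
    rw [dif_pos P.2] at this
    rw [show g P = g ⟨P.1, P.2⟩ from rfl, this]
    refine Finset.sum_congr rfl fun Q hQ => ?_
    rw [Finset.mem_ssubsets] at hQ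
    have hQB : Q ∈ B M := by
      simp only [B, Finset.mem_filter, Finset.mem_powerset]
      exact ⟨hQ.1.trans hPA.1, by have := Finset.card_lt_card hQ; omega⟩
    have h01 : ∀ x : ZMod 2, x = if x = 1 then 1 else 0 := by decide
    simp only [Finset.mem_filter, hQB, true_and]
    exact h01 _
  have h1 := (Finset.card_le_card hcover).trans Finset.card_biUnion_le
  have h2 : ∀ M ∈ (Finset.range n).powersetCard m,
      ((B M).powerset.biUnion (F M)).card * 2 ^ m.choose r
        ≤ 2 ^ (r * m ^ (r - 1)) * 2 ^ Fintype.card ι := by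
    intro M hM
    have hF : ∀ H, (F M H).card * 2 ^ m.choose r = 2 ^ Fintype.card ι := by
      intro H
      rw [← hA M hM]
      exact card_prescribed (A M) (v H)
    calc _ ≤ (∑ H ∈ (B M).powerset, (F M H).card) * 2 ^ m.choose r :=
          Nat.mul_le_mul_right _ Finset.card_biUnion_le
      _ = 2 ^ (B M).card * 2 ^ Fintype.card ι := by
          rw [Finset.sum_mul, Finset.sum_congr rfl (fun H _ => hF H)]
          simp [Finset.card_powerset]
      _ ≤ _ := Nat.mul_le_mul_right _ (Nat.pow_le_pow_right (by norm_num)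
          (card_small r m hm M (Finset.mem_powersetCard.mp hM).2))
  have h3 := Nat.mul_le_mul_right (2 ^ m.choose r) h1
  rw [Finset.sum_mul] at h3
  have h4 := h3.trans (Finset.sum_le_sum h2)
  rw [Finset.sum_const, Finset.card_powersetCard, Finset.card_range, smul_eq_mul,
    Finset.card_univ, Fintype.card_fun, ZMod.card, ← mul_assoc, mul_comm] at h4
  have h5 := Nat.le_of_mul_le_mul_right h4 (by positivity)
  have h6 := Nat.mul_le_mul_right (2 ^ (r * m ^ (r - 1))) (Nat.choose_le_pow n m)
  omega

theorem exists_no_mono (ℓ n m r : ℕ) (hℓ : 2 ≤ ℓ) (hr : 1 ≤ r) (hm : 1 ≤ m)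
    (hlt : n ^ m * 2 ^ (r * m ^ (r - 1)) < 2 ^ (m.choose r)) :
    ∃ φ : Finset ℕ → Fin ℓ, ¬ HasMonoDaisy n r m ℓ φ := by
  classical
  obtain ⟨g, hg⟩ := exists_good n m r hm hlt
  let e : ZMod 2 → Fin ℓ := fun x => if x = 0 then ⟨0, by omega⟩ else ⟨1, by omega⟩
  have he : ∀ c, ∃ c', ∀ x, e x = c → x = c' := by
    intro c
    by_cases hc : c.1 = 0
    · refine ⟨0, fun x hx => ?_⟩
      by_contra h0
      simp only [e, h0, if_false] at hx
      rw [← hx] at hc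
      simp at hc
    · refine ⟨1, fun x hx => ?_⟩
      have h01 : ∀ x : ZMod 2, x = 0 ∨ x = 1 := by decide
      refine (h01 x).resolve_left fun h0 => ?_
      simp only [e, h0, if_true] at hx
      rw [← hx] at hc
      simp at hc
  refine ⟨fun S => e (∑ T ∈ S.powersetCard r, g T), ?_⟩
  rintro ⟨K, M, hK, hM, hKM, hMc, c, hc⟩
  obtain ⟨c', hc'⟩ := he c
  apply hg M hM hMc (fun Q => (if Q = ∅ then c' else 0) -
    ∑ T ∈ ((K ∪ M).powersetCard r).filter (fun T => T ∩ M = Q), g T)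
  intro P hP hPr
  have h1 := hc' _ (hc P hP hPr)
  rw [poly_decomp r g K M P hKM hP hPr] at h1
  rw [Finset.sum_sub_distrib, Finset.sum_ite_eq', if_pos, ← h1]
  · ring
  · rw [Finset.mem_ssubsets]
    exact Finset.empty_ssubset.mpr (Finset.card_pos.mp (by omega))

theorem pow_le_mul_choose (m r : ℕ) (hr : 1 ≤ r) (hm : r ≤ m) :
    m ^ r ≤ (r ^ r * r.factorial) * m.choose r := by
  have h1 : m ≤ r * (m + 1 - r) := by
    obtain ⟨k, rfl⟩ := Nat.exists_eq_add_of_le hm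
    rw [show r + k + 1 - r = k + 1 by omega]
    nlinarith
  calc m ^ r ≤ (r * (m + 1 - r)) ^ r := Nat.pow_le_pow_left h1 r
    _ = r ^ r * (m + 1 - r) ^ r := mul_pow _ _ _
    _ ≤ r ^ r * m.descFactorial r := Nat.mul_le_mul_left _ (Nat.pow_sub_le_descFactorial m r)
    _ = _ := by rw [Nat.descFactorial_eq_factorial_mul_choose, mul_assoc]

theorem daisyRamsey_lower_bound (ℓ r : ℕ) (hℓ : 2 ≤ ℓ) (hr : 2 ≤ r) :
    ∃ ε : ℝ, 0 < ε ∧ ∀ m : ℕ, r < m →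
      (2 : ℝ) ^ (ε * (m : ℝ) ^ (r - 1)) ≤ (daisyRamsey r m ℓ : ℝ) := by
  obtain ⟨B, hB⟩ : ∃ B, B = r ^ r * r.factorial := ⟨_, rfl⟩
  have hB1 : 1 ≤ B := by rw [hB]; exact Nat.succ_le_of_lt (by positivity)
  obtain ⟨m0, hm0⟩ : ∃ m0, m0 = 4 * r * B := ⟨_, rfl⟩
  have hm01 : 1 ≤ m0 := by rw [hm0]; exact Nat.succ_le_of_lt (by positivity)
  have hm0R : (1 : ℝ) ≤ m0 := by exact_mod_cast hm01
  have hBR : (1 : ℝ) ≤ B := by exact_mod_cast hB1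
  have hrR : (2 : ℝ) ≤ r := by exact_mod_cast hr
  have hm0eq : (m0 : ℝ) = 4 * r * B := by rw [hm0]; push_cast; ring
  refine ⟨1 / (m0 : ℝ) ^ (r - 1), by positivity, fun m hm => ?_⟩
  have hmem : daisyRamsey r m ℓ ∈ {n | ∀ φ : Finset ℕ → Fin ℓ, HasMonoDaisy n r m ℓ φ} := by
    apply Nat.sInf_mem
    obtain ⟨N, hN⟩ := ramsey_finite ℓ r m
    refine ⟨N, fun φ => ?_⟩
    obtain ⟨M, hM, hMc, c, hc⟩ := hN (Finset.range N) (by simp) φ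
    exact ⟨∅, M, by simp, hM, by simp, hMc, c, fun P hP hPr => by simpa using hc P hP hPr⟩
  generalize daisyRamsey r m ℓ = n at hmem
  rw [Set.mem_setOf_eq] at hmem
  have hnm : m ≤ n := by
    obtain ⟨K, M, _, hM, _, hMc, _⟩ := hmem (fun _ => ⟨0, by omega⟩)
    have := Finset.card_le_card hM
    simpa [hMc] using this
  have hn2 : (2 : ℝ) ≤ n := by exact_mod_cast (by omega : 2 ≤ n)
  by_cases hmm : m < m0
  · refine le_trans ?_ hn2
    calc (2 : ℝ) ^ (1 / (m0 : ℝ) ^ (r - 1) * (m : ℝ) ^ (r - 1)) ≤ (2 : ℝ) ^ (1 : ℝ) := by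
          apply Real.rpow_le_rpow_of_exponent_le (by norm_num)
          rw [one_div_mul_eq_div, div_le_one (by positivity)]
          gcongr
      _ = 2 := by simp
  · push Not at hmm
    by_contra hlt
    push Not at hlt
    obtain ⟨φ, hφ⟩ : ∃ φ : Finset ℕ → Fin ℓ, ¬ HasMonoDaisy n r m ℓ φ := by
      apply exists_no_mono ℓ n m r hℓ (by omega) (by omega)
      have hmmR : (m0 : ℝ) ≤ m := by exact_mod_cast hmm
      have hch : (m : ℝ) ^ r ≤ B * m.choose r := by
        have := pow_le_mul_choose m r (by omega) hm.le
        rw [← hB] at this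
        exact_mod_cast this
      have hpow : (m : ℝ) ^ r = (m : ℝ) ^ (r - 1) * m := by
        rw [← pow_succ]; congr 1; omega
      have hε : 1 / (m0 : ℝ) ^ (r - 1) ≤ 1 / (4 * B) := by
        apply one_div_le_one_div_of_le (by positivity)
        calc (4 * B : ℝ) ≤ m0 := by rw [hm0eq]; nlinarith
          _ ≤ (m0 : ℝ) ^ (r - 1) := le_self_pow₀ hm0R (by omega)
      have hexp : (1 / (m0 : ℝ) ^ (r - 1) * (m : ℝ) ^ (r - 1)) * m + (r * m ^ (r - 1) : ℕ)
          ≤ (m.choose r : ℝ) := by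
        have e1 : (1 / (m0 : ℝ) ^ (r - 1) * (m : ℝ) ^ (r - 1)) * m ≤ 1 / (4 * B) * (m : ℝ) ^ r := by
          rw [mul_assoc, ← hpow]; gcongr
        have e2 : ((r * m ^ (r - 1) : ℕ) : ℝ) ≤ 1 / (4 * B) * (m : ℝ) ^ r := by
          rw [one_div_mul_eq_div, le_div_iff₀ (by positivity), hpow]
          push_cast
          have : (m : ℝ) ^ (r - 1) * (4 * r * B) ≤ (m : ℝ) ^ (r - 1) * m := by
            rw [← hm0eq]; gcongr
          linarith
        have e3 : 1 / (4 * B) * (m : ℝ) ^ r ≤ m.choose r / 4 := by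
          rw [one_div_mul_eq_div, div_le_iff₀ (by positivity)]
          linarith
        have : (0 : ℝ) ≤ m.choose r := by positivity
        linarith
      have hnR : (n : ℝ) ^ m < (2 : ℝ) ^ ((1 / (m0 : ℝ) ^ (r - 1) * (m : ℝ) ^ (r - 1)) * m) := by
        rw [Real.rpow_mul (by norm_num), Real.rpow_natCast]
        exact pow_lt_pow_left₀ hlt (by positivity) (by omega)
      have : (n : ℝ) ^ m * 2 ^ (r * m ^ (r - 1)) < 2 ^ (m.choose r) := by
        calc (n : ℝ) ^ m * 2 ^ (r * m ^ (r - 1)) 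
            < (2 : ℝ) ^ ((1 / (m0 : ℝ) ^ (r - 1) * (m : ℝ) ^ (r - 1)) * m) * 2 ^ (r * m ^ (r - 1)) := by
              gcongr
          _ = (2 : ℝ) ^ ((1 / (m0 : ℝ) ^ (r - 1) * (m : ℝ) ^ (r - 1)) * m + (r * m ^ (r - 1) : ℕ)) := by
              rw [Real.rpow_add (by norm_num), Real.rpow_natCast]
          _ ≤ (2 : ℝ) ^ (m.choose r : ℝ) :=
              Real.rpow_le_rpow_of_exponent_le (by norm_num) hexp
          _ = _ := Real.rpow_natCast _ _
      exact_mod_cast this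
    exact hφ (hmem φ)
end

section
/- If n, m, r, ℓ ≥ 2 are integers with n ≥ m ≥ r satisfying m^r · n^m · ℓ^{1 - C(m,r)} < 1 (where C(m,r) is the binomial coefficient), then D_r(m;ℓ) ≥ n. -/
open Finset in
/-- Finite Ramsey theorem for hypergraphs. -/
theorem ramsey_aux (ℓ : ℕ) (hℓ : 0 < ℓ) (r : ℕ) : ∀ m : ℕ, ∃ N : ℕ, ∀ X : Finset ℕ, N ≤ X.card →
    ∀ φ : Finset ℕ → Fin ℓ, ∃ M ⊆ X, M.card = m ∧ ∃ c, ∀ P ⊆ M, P.card = r → φ P = c := by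
  induction r with
  | zero =>
    intro m
    refine ⟨m, fun X hX φ => ?_⟩
    obtain ⟨M, hM, hc⟩ := exists_subset_card_eq hX
    refine ⟨M, hM, hc, φ ∅, fun P _ hP => ?_⟩
    rw [card_eq_zero.1 hP]
  | succ r ih =>
    have key : ∀ k : ℕ, ∃ N : ℕ, ∀ X : Finset ℕ, N ≤ X.card → ∀ φ : Finset ℕ → Fin ℓ,
        ∃ Y ⊆ X, Y.card = k ∧ ∃ f : ℕ → Fin ℓ, ∀ P ⊆ Y, P.card = r + 1 →
          ∀ x ∈ P, (∀ y ∈ P, x ≤ y) → φ P = f x := by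
      intro k
      induction k with
      | zero =>
        refine ⟨0, fun X _ φ => ⟨∅, by simp, by simp, fun _ => ⟨0, hℓ⟩, ?_⟩⟩
        intro P hP hc
        rw [subset_empty.1 hP] at hc
        simp at hc
      | succ k ihk =>
        obtain ⟨N', hN'⟩ := ihk
        obtain ⟨N, hN⟩ := ih N'
        refine ⟨N + 1, fun X hX φ => ?_⟩
        have hne : X.Nonempty := card_pos.1 (by omega)
        set x := X.min' hne with hx
        have hxX : x ∈ X := X.min'_mem hne
        have h1 : N ≤ (X.erase x).card := by rw [card_erase_of_mem hxX]; omega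
        obtain ⟨Z, hZ, hZc, c, hc⟩ := hN (X.erase x) h1 (fun P => φ (insert x P))
        obtain ⟨Y, hY, hYc, f, hf⟩ := hN' Z hZc.ge φ
        have hxY : x ∉ Y := fun h => by simpa using hZ (hY h)
        refine ⟨insert x Y, ?_, by rw [card_insert_of_notMem hxY, hYc], Function.update f x c, ?_⟩
        · intro y hy
          rcases mem_insert.1 hy with h | h
          · rw [h]; exact hxX
          · exact mem_of_mem_erase (hZ (hY h))
        · intro P hP hPc z hz hmin
          by_cases hxP : x ∈ P
          · have hzX : z ∈ X := by
              rcases mem_insert.1 (hP hz) with h | h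
              · rw [h]; exact hxX
              · exact mem_of_mem_erase (hZ (hY h))
            have hzx : z = x := le_antisymm (hmin x hxP) (X.min'_le z hzX)
            subst hzx
            rw [Function.update_self, ← insert_erase hxP]
            apply hc
            · refine Subset.trans ?_ hY
              intro y hy
              rw [mem_erase] at hy
              exact (mem_insert.1 (hP hy.2)).resolve_left hy.1
            · rw [card_erase_of_mem hxP, hPc]; rfl
          · have hzx : z ≠ x := fun h => hxP (h ▸ hz)
            rw [Function.update_of_ne hzx]
            refine hf P ?_ hPc z hz hmin
            intro y hy
            exact (mem_insert.1 (hP hy)).resolve_left (fun h => hxP (h ▸ hy))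
    intro m
    obtain ⟨N, hN⟩ := key (ℓ * m)
    refine ⟨N, fun X hX φ => ?_⟩
    obtain ⟨Y, hY, hYc, f, hf⟩ := hN X hX φ
    have : Nonempty (Fin ℓ) := ⟨⟨0, hℓ⟩⟩
    obtain ⟨c, -, hc⟩ := exists_le_card_fiber_of_mul_le_card_of_maps_to (s := Y)
      (t := (univ : Finset (Fin ℓ))) (f := f) (n := m) (by simp) univ_nonempty (by simp [hYc])
    obtain ⟨M, hM, hMc⟩ := exists_subset_card_eq hc
    refine ⟨M, fun y hy => hY (mem_filter.1 (hM hy)).1, hMc, c, fun P hP hPc => ?_⟩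
    have hne : P.Nonempty := card_pos.1 (by omega)
    rw [hf P (fun y hy => (mem_filter.1 (hM (hP hy))).1) hPc (P.min' hne) (P.min'_mem hne)
      (fun y hy => P.min'_le y hy)]
    exact (mem_filter.1 (hM (hP (P.min'_mem hne)))).2

/-- `T` is monochromatic under `φ`. -/
def MonoOn {V : Type*} {ℓ : ℕ} (φ : V → Fin ℓ) (T : Finset V) : Prop := ∃ c, ∀ v ∈ T, φ v = c

open Finset Classical in
/-- Colorings avoiding `S`. -/
noncomputable def avoid {V : Type*} [Fintype V] (ℓ : ℕ) (S : Finset (Finset V)) :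
    Finset (V → Fin ℓ) := univ.filter fun φ => ∀ T ∈ S, ¬ MonoOn φ T

open Finset Classical in
/-- Colorings avoiding `S` but monochromatic on `T`. -/
noncomputable def avoidBad {V : Type*} [Fintype V] (ℓ : ℕ) (T : Finset V) (S : Finset (Finset V)) :
    Finset (V → Fin ℓ) := (avoid ℓ S).filter fun φ => MonoOn φ T

open Finset Classical in
theorem indep_aux {V : Type*} [Fintype V] (ℓ : ℕ) (T : Finset V) (S : Finset (Finset V))
    (hS : ∀ U ∈ S, Disjoint T U) (hT : T.Nonempty) :
    ℓ ^ T.card * (avoidBad ℓ T S).card ≤ ℓ * (avoid ℓ S).card := by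
  obtain ⟨t, ht⟩ := hT
  have e1 : ℓ ^ T.card * (avoidBad ℓ T S).card
      = ((univ : Finset (T → Fin ℓ)) ×ˢ avoidBad ℓ T S).card := by
    rw [card_product]; simp
  have e2 : ℓ * (avoid (V := V) ℓ S).card = ((univ : Finset (Fin ℓ)) ×ˢ avoid ℓ S).card := by
    rw [card_product]; simp
  rw [e1, e2]
  refine card_le_card_of_injOn
    (fun p => (p.2 t, fun v => if hv : v ∈ T then p.1 ⟨v, hv⟩ else p.2 v)) ?_ ?_
  · rintro ⟨ψ, φ⟩ hp
    simp only [coe_product, coe_univ, Set.mem_prod, mem_coe, avoidBad, mem_filter, avoid,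
      mem_univ, true_and, Set.mem_univ] at hp ⊢
    intro U hU ⟨c, hc⟩
    refine hp.1 U hU ⟨c, fun v hv => ?_⟩
    have := hc v hv
    beta_reduce at this
    rwa [dif_neg (fun hvT => disjoint_left.1 (hS U hU) hvT hv)] at this
  · rintro ⟨ψ, φ⟩ hp ⟨ψ', φ'⟩ hp' heq
    simp only [coe_product, coe_univ, Set.mem_prod, mem_coe, avoidBad, mem_filter,
      Set.mem_univ, true_and] at hp hp'
    obtain ⟨-, c, hc⟩ := hp
    obtain ⟨-, c', hc'⟩ := hp'
    simp only [Prod.mk.injEq] at heq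
    obtain ⟨h1, h2⟩ := heq
    have h3 : ψ = ψ' := by
      funext v
      have := congrFun h2 v.1
      simpa using this
    have h4 : φ = φ' := by
      funext v
      by_cases hv : v ∈ T
      · rw [hc v hv, hc' v hv, ← hc t ht, ← hc' t ht]; exact h1
      · have := congrFun h2 v
        simpa [hv] using this
    rw [h3, h4]

open Finset Classical in
theorem lll_step {V : Type*} [Fintype V] (ℓ C D : ℕ) (hℓ : 0 < ℓ) (F : Finset (Finset V))
    (hC : ∀ T ∈ F, T.card = C) (hC0 : 0 < C)
    (hD : ∀ T ∈ F, ∃ G : Finset (Finset V), G.card ≤ D ∧ ∀ U ∈ F, ¬ Disjoint T U → U ∈ G)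
    (hbound : 4 * D * ℓ ≤ ℓ ^ C) : ∀ (k : ℕ) (S : Finset (Finset V)), S ⊆ F → S.card = k →
      ∀ T ∈ F, ℓ ^ C * (avoidBad ℓ T S).card ≤ 2 * ℓ * (avoid ℓ S).card := by
  intro k
  induction k using Nat.strong_induction_on with
  | _ k ih =>
  intro S hSF hSk T hT
  set S1 := S.filter fun U => ¬ Disjoint T U with hS1
  set S2 := S.filter fun U => Disjoint T U with hS2
  have hS2S : S2 ⊆ S := filter_subset _ _
  have hind := indep_aux ℓ T S2 (fun U hU => (mem_filter.1 hU).2)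
    (card_pos.1 (by rw [hC T hT]; exact hC0))
  rw [hC T hT] at hind
  have hmono : (avoidBad ℓ T S).card ≤ (avoidBad ℓ T S2).card := by
    refine card_le_card (fun φ hφ => ?_)
    simp only [avoidBad, avoid, mem_filter, mem_univ, true_and] at hφ ⊢
    exact ⟨fun U hU => hφ.1 U (hS2S hU), hφ.2⟩
  have hcov : (avoid ℓ S2).card ≤ (avoid ℓ S).card + ∑ U ∈ S1, (avoidBad ℓ U S2).card := by
    refine le_trans (card_le_card (t := avoid ℓ S ∪ S1.biUnion fun U => avoidBad ℓ U S2) ?_) ?_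
    · intro φ hφ
      by_cases hφS : φ ∈ avoid ℓ S
      · exact mem_union_left _ hφS
      · refine mem_union_right _ ?_
        have : ∃ U ∈ S, MonoOn φ U := by
          by_contra hcon
          push Not at hcon
          exact hφS (by simpa [avoid] using hcon)
        obtain ⟨U, hU, hm⟩ := this
        rw [mem_biUnion]
        refine ⟨U, ?_, mem_filter.2 ⟨hφ, hm⟩⟩
        rw [hS1, mem_filter]
        refine ⟨hU, fun hd => ?_⟩
        exact (mem_filter.1 hφ).2 U (mem_filter.2 ⟨hU, hd⟩) hm
    · exact (card_union_le _ _).trans (Nat.add_le_add_left card_biUnion_le _)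
  have hS1D : S1.card ≤ D := by
    obtain ⟨G, hG, hGU⟩ := hD T hT
    refine (card_le_card (fun U hU => ?_)).trans hG
    rw [hS1, mem_filter] at hU
    exact hGU U (hSF hU.1) hU.2
  have hsum : ℓ ^ C * ∑ U ∈ S1, (avoidBad ℓ U S2).card ≤ D * (2 * ℓ * (avoid ℓ S2).card) := by
    rcases S1.eq_empty_or_nonempty with he | hne
    · rw [he]; simp
    · have hlt : S2.card < k := by
        rw [← hSk]
        refine card_lt_card ⟨hS2S, fun hsub => ?_⟩
        obtain ⟨U, hU⟩ := hne
        rw [hS1, mem_filter] at hU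
        exact hU.2 (mem_filter.1 (hsub hU.1)).2
      rw [mul_sum]
      refine (sum_le_card_nsmul S1 _ (2 * ℓ * (avoid ℓ S2).card) (fun U hU => ?_)).trans ?_
      · exact ih _ hlt S2 (hS2S.trans hSF) rfl U (hSF (mem_filter.1 hU).1)
      · rw [smul_eq_mul]; exact Nat.mul_le_mul_right _ hS1D
  have hp : 0 < ℓ ^ C := pow_pos hℓ C
  have hhalf : (avoid ℓ S2).card ≤ 2 * (avoid ℓ S).card := by
    refine Nat.le_of_mul_le_mul_left ?_ hp
    nlinarith [Nat.mul_le_mul_left (ℓ ^ C) hcov, Nat.mul_le_mul_right (avoid (V := V) ℓ S2).card hbound]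
  calc ℓ ^ C * (avoidBad ℓ T S).card ≤ ℓ ^ C * (avoidBad ℓ T S2).card :=
        Nat.mul_le_mul_left _ hmono
    _ ≤ ℓ * (avoid ℓ S2).card := hind
    _ ≤ ℓ * (2 * (avoid ℓ S).card) := Nat.mul_le_mul_left _ hhalf
    _ = _ := by ring

open Finset Classical in
/-- Symmetric local lemma for proper colorings of uniform hypergraphs. -/
theorem lll {V : Type*} [Fintype V] (ℓ C D : ℕ) (hℓ : 0 < ℓ) (F : Finset (Finset V))
    (hC : ∀ T ∈ F, T.card = C) (hC0 : 0 < C) (hD0 : 0 < D)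
    (hD : ∀ T ∈ F, ∃ G : Finset (Finset V), G.card ≤ D ∧ ∀ U ∈ F, ¬ Disjoint T U → U ∈ G)
    (hbound : 4 * D * ℓ ≤ ℓ ^ C) : ∃ φ : V → Fin ℓ, ∀ T ∈ F, ¬ MonoOn φ T := by
  have key : ∀ S : Finset (Finset V), S ⊆ F → 0 < (avoid ℓ S).card := by
    intro S
    induction S using Finset.induction_on with
    | empty =>
      intro _
      refine card_pos.2 ⟨fun _ => ⟨0, hℓ⟩, by simp [avoid]⟩
    | insert T S hTS ih =>
      intro hsub
      have hS : S ⊆ F := (subset_insert _ _).trans hsub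
      have h0 := ih hS
      have h1 := lll_step ℓ C D hℓ F hC hC0 hD hbound _ S hS rfl T (hsub (mem_insert_self _ _))
      have h2 : avoid ℓ (insert T S) = (avoid ℓ S).filter fun φ => ¬ MonoOn φ T := by
        ext φ
        simp only [avoid, mem_filter, mem_univ, true_and, mem_insert, forall_eq_or_imp]
        tauto
      have h3 := card_filter_add_card_filter_not (s := avoid (V := V) ℓ S) (fun φ => MonoOn φ T)
      change (avoidBad ℓ T S).card + _ = _ at h3
      rw [h2]
      by_contra hcon
      have h4 : (avoidBad ℓ T S).card = (avoid ℓ S).card := by omega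
      rw [h4] at h1
      have h5 := Nat.le_of_mul_le_mul_right h1 h0
      nlinarith
  obtain ⟨φ, hφ⟩ := card_pos.1 (key F (Subset.refl _))
  exact ⟨φ, (mem_filter.1 hφ).2⟩

open Finset in
/-- The daisy with kernel `K` and petals from `M`. -/
def daisy {α : Type*} [DecidableEq α] (r : ℕ) (K M : Finset α) : Finset (Finset α) :=
  (powersetCard r M).image fun P => K ∪ P

open Finset in
theorem exists_coloring (n m r ℓ : ℕ) (hr : 2 ≤ r) (hℓ : 2 ≤ ℓ) (hnm : m ≤ n) (hmr : r ≤ m)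
    (h : m ^ r * n ^ m * ℓ ≤ ℓ ^ (m.choose r)) :
    ∃ φ : Finset (Fin n) → Fin ℓ, ∀ K M, Disjoint K M → M.card = m → ¬ MonoOn φ (daisy r K M) := by
  let F : Finset (Finset (Finset (Fin n))) :=
    ((univ : Finset (Finset (Fin n) × Finset (Fin n))).filter
      fun p => Disjoint p.1 p.2 ∧ p.2.card = m).image fun p => daisy r p.1 p.2
  have hFm : ∀ T, T ∈ F ↔ ∃ K M : Finset (Fin n), (Disjoint K M ∧ M.card = m) ∧ daisy r K M = T := by
    intro T; simp [F]
  have hCF : ∀ T ∈ F, T.card = m.choose r := by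
    intro T hT
    obtain ⟨K, M, ⟨hd, hM⟩, rfl⟩ := (hFm T).1 hT
    rw [daisy, card_image_of_injOn, card_powersetCard, hM]
    intro P hP Q hQ hPQ
    simp only [mem_coe, mem_powersetCard] at hP hQ
    have e : ∀ P ⊆ M, (K ∪ P) \ K = P := fun P hP => by
      rw [union_sdiff_left, sdiff_eq_self_of_disjoint]
      exact (hd.mono_right hP).symm
    rw [← e P hP.1, ← e Q hQ.1]
    beta_reduce at hPQ
    rw [hPQ]
  have hmain := lll ℓ (m.choose r) (m.choose r * n.choose m) (by omega) F hCF
    (Nat.choose_pos hmr) (Nat.mul_pos (Nat.choose_pos hmr) (Nat.choose_pos hnm))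
  suffices hs : (∀ T ∈ F, ∃ G : Finset (Finset (Finset (Fin n))), G.card ≤ m.choose r * n.choose m ∧
      ∀ U ∈ F, ¬ Disjoint T U → U ∈ G) ∧ 4 * (m.choose r * n.choose m) * ℓ ≤ ℓ ^ m.choose r by
    obtain ⟨φ, hφ⟩ := hmain hs.1 hs.2
    exact ⟨φ, fun K M hd hM => hφ _ ((hFm _).2 ⟨K, M, ⟨hd, hM⟩, rfl⟩)⟩
  constructor
  · intro T hT
    refine ⟨(T ×ˢ powersetCard m (univ : Finset (Fin n))).image
      fun p => daisy r (p.1 \ p.2) p.2, ?_, ?_⟩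
    · refine card_image_le.trans ?_
      rw [card_product, hCF T hT, card_powersetCard, card_univ, Fintype.card_fin]
    · intro U hUF hnd
      obtain ⟨K, M, ⟨hd, hM⟩, rfl⟩ := (hFm U).1 hUF
      obtain ⟨s, hsT, hsU⟩ := not_disjoint_iff.1 hnd
      rw [mem_image]
      refine ⟨(s, M), by simp [hsT, hM], ?_⟩
      rw [daisy, mem_image] at hsU
      obtain ⟨P, hP, rfl⟩ := hsU
      rw [mem_powersetCard] at hP
      have : (K ∪ P) \ M = K := by
        rw [union_sdiff_distrib, sdiff_eq_empty_iff_subset.2 hP.1, union_empty,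
          sdiff_eq_self_of_disjoint hd]
      simp only [this]
  · have aux : ∀ a b : ℕ, 2 ≤ b → 2 * a.choose b ≤ a ^ b := by
      intro a b hb
      have h1 : b.factorial * a.choose b ≤ a ^ b := by
        rw [← Nat.descFactorial_eq_factorial_mul_choose]; exact Nat.descFactorial_le_pow a b
      have h2 : 2 ≤ b.factorial := hb.trans (Nat.self_le_factorial b)
      exact (Nat.mul_le_mul_right _ h2).trans h1
    calc 4 * (m.choose r * n.choose m) * ℓ = (2 * m.choose r) * (2 * n.choose m) * ℓ := by ring
      _ ≤ m ^ r * n ^ m * ℓ :=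
        Nat.mul_le_mul_right _ (Nat.mul_le_mul (aux m r hr) (aux n m (hr.trans hmr)))
      _ ≤ _ := h

/-- If `n, m, r, ℓ ≥ 2` are integers with `n ≥ m ≥ r` satisfying
`m^r · n^m · ℓ^(1 - C(m,r)) < 1`, then `D_r(m;ℓ) ≥ n`. -/
theorem daisyRamsey_LLL_lower_bound (n m r ℓ : ℕ)
    (hn : 2 ≤ n) (hm : 2 ≤ m) (hr : 2 ≤ r) (hℓ : 2 ≤ ℓ)
    (hnm : m ≤ n) (hmr : r ≤ m)
    (h : (m : ℝ) ^ r * (n : ℝ) ^ m * (ℓ : ℝ) ^ ((1 : ℤ) - (Nat.choose m r : ℤ)) < 1) :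
    n ≤ daisyRamsey r m ℓ := by
  have hnat : m ^ r * n ^ m * ℓ ≤ ℓ ^ (m.choose r) := by
    have hl : (0 : ℝ) < ℓ := by exact_mod_cast (by omega : 0 < ℓ)
    rw [zpow_sub₀ hl.ne', zpow_one, zpow_natCast, ← mul_div_assoc, div_lt_one (by positivity)] at h
    exact_mod_cast h.le
  obtain ⟨φ, hφ⟩ := exists_coloring n m r ℓ hr hℓ hnm hmr hnat
  have hne : {n | ∀ φ : Finset ℕ → Fin ℓ, HasMonoDaisy n r m ℓ φ}.Nonempty := by
    obtain ⟨N, hN⟩ := ramsey_aux ℓ (by omega) r m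
    refine ⟨N, fun ψ => ?_⟩
    obtain ⟨M, hM, hMc, c, hc⟩ := hN (Finset.range N) (by simp) ψ
    exact ⟨∅, M, by simp, hM, by simp, hMc, c, fun P hP hPc => by simpa using hc P hP hPc⟩
  refine le_csInf hne (fun k hk => ?_)
  by_contra hlt
  push Not at hlt
  let pull : Finset ℕ → Finset (Fin n) := fun S => Finset.univ.filter fun i => i.1 ∈ S
  obtain ⟨K, M, hK, hM, hd, hMc, c, hc⟩ := hk (fun S => φ (pull S))
  have hmap : ∀ S : Finset ℕ, S ⊆ Finset.range k → (pull S).map Fin.valEmbedding = S := by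
    intro S hS
    ext x
    simp only [pull, Finset.mem_map, Finset.mem_filter, Finset.mem_univ, true_and,
      Fin.valEmbedding_apply]
    constructor
    · rintro ⟨i, hi, rfl⟩; exact hi
    · intro hx
      exact ⟨⟨x, (Finset.mem_range.1 (hS hx)).trans hlt⟩, hx, rfl⟩
  refine hφ (pull K) (pull M) ?_ ?_ ⟨c, ?_⟩
  · rw [← Finset.disjoint_map Fin.valEmbedding, hmap K hK, hmap M hM]; exact hd
  · rw [← Finset.card_map Fin.valEmbedding, hmap M hM, hMc]
  · intro v hv
    rw [daisy, Finset.mem_image] at hv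
    obtain ⟨P, hP, rfl⟩ := hv
    rw [Finset.mem_powersetCard] at hP
    have h1 := hc (P.map Fin.valEmbedding)
      (by rw [← hmap M hM]; exact Finset.map_subset_map.2 hP.1) (by rw [Finset.card_map, hP.2])
    rw [← h1]
    congr 1
    ext i
    simp [pull, Fin.val_inj]
end

section
/- For every real ε > 0 there exists an integer r₀ such that for every integer r ≥ r₀ the following holds: if m is an integer with (1+ε)·r ≤ m ≤ (2−ε)·r, then t_{⌊εr/2⌋}(D_r(m)) ≤ R_r(m). -/
/-- The coloring `φ` of the `r`-element subsets of `[n]` admits a monochromatic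
set `Y` of size `m`: all `r`-element subsets of `Y` get the same color. -/
def HasMonoClique (n r m ℓ : ℕ) (φ : Finset ℕ → Fin ℓ) : Prop :=
  ∃ Y : Finset ℕ, Y ⊆ Finset.range n ∧ Y.card = m ∧
    ∃ c : Fin ℓ, ∀ P ⊆ Y, P.card = r → φ P = c

/-- `R_r(m;ℓ)`: the classical hypergraph Ramsey number. -/
noncomputable def ramsey (r m ℓ : ℕ) : ℕ :=
  sInf {n | ∀ φ : Finset ℕ → Fin ℓ, HasMonoClique n r m ℓ φ}

/-- The tower function: `t_0(x) = x`, `t_{i+1}(x) = 2 ^ t_i(x)`. -/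
def tower : ℕ → ℕ → ℕ
  | 0, x => x
  | i + 1, x => 2 ^ tower i x


/-! ### Upper bound (Erdős–Rado) -/

/-- Ramsey property for arbitrary ground sets. -/
def RamP (N s m : ℕ) : Prop :=
  ∀ φ : Finset ℕ → Fin 2, ∀ S : Finset ℕ, N ≤ S.card →
    ∃ Y ⊆ S, Y.card = m ∧ ∃ c : Fin 2, ∀ P ⊆ Y, P.card = s → φ P = c

lemma ramP_zero (m : ℕ) : RamP m 0 m := by
  intro φ S hS
  obtain ⟨Y, hY, hc⟩ := Finset.exists_subset_card_eq hS
  refine ⟨Y, hY, hc, φ ∅, ?_⟩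
  intro P _ hP
  rw [Finset.card_eq_zero.mp hP]

lemma refine_types (φ : Finset ℕ → Fin 2) (s q n : ℕ) (A B : Finset ℕ)
    (hA : A.card ^ s ≤ q) (hB : 2 ^ q * n ≤ B.card) :
    ∃ B' ⊆ B, n ≤ B'.card ∧ ∃ f : Finset ℕ → Fin 2,
      ∀ P ⊆ A, P.card = s → ∀ b ∈ B', φ (insert b P) = f P := by
  classical
  have hcard : ((A.powersetCard s).powerset).card * n ≤ B.card := by
    refine le_trans (Nat.mul_le_mul_right n ?_) hB
    rw [Finset.card_powerset, Finset.card_powersetCard]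
    exact Nat.pow_le_pow_right (by norm_num) ((Nat.choose_le_pow _ _).trans hA)
  obtain ⟨T, hT, hn⟩ := Finset.exists_le_card_fiber_of_mul_le_card_of_maps_to
    (s := B) (t := (A.powersetCard s).powerset)
    (f := fun b => (A.powersetCard s).filter (fun P => φ (insert b P) = 1))
    (fun b _ => by simp [Finset.filter_subset]) ⟨∅, by simp⟩ hcard
  refine ⟨_, Finset.filter_subset _ _, hn, fun P => if P ∈ T then 1 else 0, ?_⟩
  intro P hP hs b hb
  have hb2 := (Finset.mem_filter.mp hb).2
  have hm : P ∈ T ↔ φ (insert b P) = 1 := by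
    rw [← hb2]; simp [hP, hs]
  by_cases h : P ∈ T
  · simp only [h, if_true]; exact hm.mp h
  · simp only [h, if_false]
    have := fun h' => h (hm.mpr h')
    rcases Fin.exists_fin_two.mp ⟨φ (insert b P), rfl⟩ with h0 | h0
    · exact h0
    · exact absurd h0 this

lemma end_homog (φ : Finset ℕ → Fin 2) (s M : ℕ) (S : Finset ℕ) (t j : ℕ) (ht : t ≤ M)
    (hS : (2 ^ (M ^ s + 1)) ^ (t + j + 1) ≤ S.card) :
    ∃ A ⊆ S, ∃ B ⊆ S, Disjoint A B ∧ A.card = t ∧ (2 ^ (M ^ s + 1)) ^ j ≤ B.card ∧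
      ∃ f : Finset ℕ → Fin 2,
        (∀ P ⊆ A, P.card = s → ∀ b ∈ B, φ (insert b P) = f P) ∧
        (∀ Q ⊆ A, Q.card = s + 1 → ∃ P ⊆ Q, P.card = s ∧ φ Q = f P) := by
  classical
  induction t generalizing j with
  | zero =>
    obtain ⟨B, hB, hc, f, hf⟩ := refine_types φ s (0 ^ s + M ^ s) ((2 ^ (M ^ s + 1)) ^ j) ∅ S (by simp) (by
      refine le_trans ?_ hS
      have h0 : (0:ℕ) ^ s ≤ 1 := by
        rcases s with _ | s <;> simp
      have h2 : 2 ^ (0 ^ s + M ^ s) ≤ 2 ^ (M ^ s + 1) :=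
        Nat.pow_le_pow_right (by norm_num) (by omega)
      rw [zero_add, pow_succ, mul_comm]
      exact Nat.mul_le_mul_left _ h2)
    refine ⟨∅, by simp, B, hB, by simp, rfl, hc, f, hf, ?_⟩
    intro Q hQ hc
    rw [Finset.subset_empty.mp hQ] at hc
    simp at hc
  | succ t ih =>
    obtain ⟨A, hA, B, hB, hd, hAc, hBc, f, hf1, hf2⟩ := ih (j + 1) (by omega)
      (by convert hS using 2; ring)
    have hpos : 0 < (2 ^ (M ^ s + 1)) ^ j := by positivity
    have hpos' : 0 < (2 ^ (M ^ s)) := by positivity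
    have hge : 2 * ((2 ^ (M ^ s)) * (2 ^ (M ^ s + 1)) ^ j) ≤ B.card := by
      refine le_trans (le_of_eq ?_) hBc
      rw [pow_succ (2 ^ (M ^ s + 1)) j]; ring
    have hpos2 : 0 < (2 ^ (M ^ s)) * (2 ^ (M ^ s + 1)) ^ j := by positivity
    obtain ⟨b, hb⟩ : B.Nonempty := Finset.card_pos.mp (by omega)
    have hbA : b ∉ A := fun h => Finset.disjoint_left.mp hd h hb
    have hcb : (insert b A).card = t + 1 := by rw [Finset.card_insert_of_notMem hbA, hAc]
    obtain ⟨B', hB', hc', f', hf'⟩ := refine_types φ s (M ^ s) ((2 ^ (M ^ s + 1)) ^ j)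
      (insert b A) (B.erase b) (by rw [hcb]; exact Nat.pow_le_pow_left ht s)
      (by rw [Finset.card_erase_of_mem hb]; omega)
    obtain ⟨b', hb'⟩ : B'.Nonempty := Finset.card_pos.mp (by omega)
    have hBB : B' ⊆ B := hB'.trans (Finset.erase_subset _ _)
    have hff : ∀ P ⊆ A, P.card = s → f' P = f P := by
      intro P hP hs
      rw [← hf1 P hP hs b' (hBB hb'), hf' P (hP.trans (Finset.subset_insert _ _)) hs b' hb']
    refine ⟨insert b A, ?_, B', hBB.trans hB, ?_, hcb, hc', f', hf', ?_⟩
    · exact Finset.insert_subset (hB hb) hA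
    · rw [Finset.disjoint_insert_left]
      exact ⟨fun h => Finset.notMem_erase b B (hB' h), hd.mono_right hBB⟩
    · intro Q hQ hQc
      by_cases hbQ : b ∈ Q
      · have hs : (Q.erase b).card = s := by rw [Finset.card_erase_of_mem hbQ]; omega
        have hsub : Q.erase b ⊆ A := by
          rwa [← Finset.subset_insert_iff]
        refine ⟨Q.erase b, Finset.erase_subset _ _, hs, ?_⟩
        rw [hff _ hsub hs, ← hf1 _ hsub hs b hb, Finset.insert_erase hbQ]
      · have hQA : Q ⊆ A := (Finset.subset_insert_iff_of_notMem hbQ).mp hQ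
        obtain ⟨P, hP, hs, he⟩ := hf2 Q hQA hQc
        exact ⟨P, hP, hs, by rw [he, hff P (hP.trans hQA) hs]⟩

lemma ramP_succ {M s m : ℕ} (h : RamP M s m) :
    RamP ((2 ^ (M ^ s + 1)) ^ (M + 1)) (s + 1) m := by
  intro φ S hS
  obtain ⟨A, hA, B, -, -, hAc, -, f, -, hf2⟩ := end_homog φ s M S M 0 le_rfl hS
  obtain ⟨Y, hY, hYc, c, hc⟩ := h f A hAc.ge
  refine ⟨Y, hY.trans hA, hYc, c, ?_⟩
  intro Q hQ hQc
  obtain ⟨P, hP, hs, he⟩ := hf2 Q (hQ.trans hY) hQc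
  rw [he, hc P (hP.trans hQ) hs]

lemma ramP_tower (m L : ℕ) (hm : 2 ≤ m) (s : ℕ) (hs : s + 3 ≤ L) :
    ∃ M, 2 ≤ M ∧ RamP M s m ∧ L * M ^ L + L ≤ tower s (L * m ^ L + L) := by
  induction s with
  | zero => exact ⟨m, hm, ramP_zero m, le_rfl⟩
  | succ s ih =>
    obtain ⟨M, hM, hR, hb⟩ := ih (by omega)
    have hE0 : 0 < (M ^ s + 1) * (M + 1) := by positivity
    have hexp : (M ^ s + 1) * (M + 1) ≤ M ^ L := by
      have h1 : 1 ≤ M ^ s := Nat.one_le_pow _ _ (by omega)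
      calc (M ^ s + 1) * (M + 1) ≤ (M ^ s * M) * (M * M) := by
            apply Nat.mul_le_mul <;> nlinarith
        _ = M ^ (s + 3) := by ring
        _ ≤ M ^ L := Nat.pow_le_pow_right (by omega) (by omega)
    refine ⟨_, ?_, ramP_succ hR, ?_⟩
    · rw [← pow_mul]
      calc 2 = 2 ^ 1 := rfl
        _ ≤ _ := Nat.pow_le_pow_right (by norm_num) (by nlinarith [Nat.zero_le (M ^ s)])
    · rw [← pow_mul, ← pow_mul, ← mul_assoc]
      show _ ≤ 2 ^ _
      set T := tower s (L * m ^ L + L)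
      generalize (M ^ s + 1) * (M + 1) = E at *
      have h1 : E * L ≤ T - L := by
        have := Nat.mul_le_mul_left L hexp
        rw [mul_comm]; omega
      have hL : L + 1 ≤ 2 ^ L := Nat.lt_two_pow_self
      have hP : 1 ≤ 2 ^ (T - L) := Nat.one_le_two_pow
      have h3 : 2 ^ (E * L) ≤ 2 ^ (T - L) := Nat.pow_le_pow_right (by norm_num) h1
      have h4 : 2 ^ (E * L) * 2 ^ L ≤ 2 ^ T := by
        rw [← pow_add]; exact Nat.pow_le_pow_right (by norm_num) (by omega)
      have hE1 : L ≤ E * L := Nat.le_mul_of_pos_left _ hE0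
      have h5 : L ≤ 2 ^ (E * L) := (Nat.lt_two_pow_self).le.trans (Nat.pow_le_pow_right (by norm_num) hE1)
      have h6 : 2 ^ (E * L) * (L + 1) ≤ 2 ^ (E * L) * 2 ^ L := Nat.mul_le_mul_left _ hL
      calc L * 2 ^ (E * L) + L ≤ L * 2 ^ (E * L) + 2 ^ (E * L) := by omega
        _ = 2 ^ (E * L) * (L + 1) := by ring
        _ ≤ 2 ^ T := h6.trans h4

lemma mem_ramsey_of_ramP {N r m : ℕ} (h : RamP N r m) (φ : Finset ℕ → Fin 2) :
    HasMonoClique N r m 2 φ := by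
  obtain ⟨Y, h1, h2, h3⟩ := h φ (Finset.range N) (by simp)
  exact ⟨Y, h1, h2, h3⟩

lemma daisy_le_of_ramP {N r s m : ℕ} (h : RamP N s m) (hm : m = r + s) :
    daisyRamsey r m 2 ≤ N := by
  apply Nat.sInf_le
  intro φ
  obtain ⟨Y, h1, h2, c, h3⟩ := h (fun P => φ (Finset.range N \ P)) (Finset.range N) (by simp)
  refine ⟨Finset.range N \ Y, Y, Finset.sdiff_subset, h1, Finset.sdiff_disjoint, h2, c, ?_⟩
  intro P hP hc
  have := h3 (Y \ P) Finset.sdiff_subset (by rw [Finset.card_sdiff_of_subset hP]; omega)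
  rw [← this]
  congr 1
  ext x
  have := @hP x
  have := @h1 x
  simp only [Finset.mem_union, Finset.mem_sdiff] at *
  tauto

/-! ### Lower bound (shift graphs) -/

open Classical in
/-- an index of a differing bit -/
noncomputable def dlt (a b : ℕ) : ℕ :=
  if h : ∃ i, a.testBit i ≠ b.testBit i then h.choose else 0

/-- the shift-graph recoloring -/
noncomputable def gcol (a b : ℕ) : ℕ := 2 * dlt a b + (a.testBit (dlt a b)).toNat

lemma dlt_spec {a b : ℕ} (h : a ≠ b) : a.testBit (dlt a b) ≠ b.testBit (dlt a b) := by
  have : ∃ i, a.testBit i ≠ b.testBit i := by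
    by_contra! h'
    exact h (Nat.eq_of_testBit_eq h')
  unfold dlt
  rw [dif_pos this]
  exact this.choose_spec

lemma dlt_lt {a b q : ℕ} (hq : 0 < q) (ha : a < 2 ^ q) (hb : b < 2 ^ q) : dlt a b < q := by
  by_cases h : ∃ i, a.testBit i ≠ b.testBit i
  · have hne : a ≠ b := by
      rintro rfl
      obtain ⟨i, hi⟩ := h
      exact hi rfl
    by_contra! hge
    apply dlt_spec hne
    have hp : 2 ^ q ≤ 2 ^ dlt a b := Nat.pow_le_pow_right (by norm_num) hge
    rw [Nat.testBit_lt_two_pow (ha.trans_le hp), Nat.testBit_lt_two_pow (hb.trans_le hp)]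
  · unfold dlt
    rwa [dif_neg h]

lemma gcol_lt {a b q : ℕ} (hq : 0 < q) (ha : a < 2 ^ q) (hb : b < 2 ^ q) : gcol a b < 2 * q := by
  have := dlt_lt hq ha hb
  have h2 := Bool.toNat_le (a.testBit (dlt a b))
  unfold gcol
  omega

lemma gcol_ne {a b c : ℕ} (h : a ≠ b) : gcol a b ≠ gcol b c := by
  intro he
  unfold gcol at he
  have h1 := Bool.toNat_le (a.testBit (dlt a b))
  have h2 := Bool.toNat_le (b.testBit (dlt b c))
  have hd : dlt a b = dlt b c := by omega
  apply dlt_spec h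
  rw [← hd] at he
  have h3 : (a.testBit (dlt a b)).toNat = (b.testBit (dlt a b)).toNat := by omega
  revert h3
  cases a.testBit (dlt a b) <;> cases b.testBit (dlt a b) <;> simp

/-- iterated shift coloring of sequences -/
noncomputable def ccol : ℕ → (ℕ → ℕ) → ℕ
  | 0, x => x 0
  | k + 1, x => gcol (ccol k x) (ccol k (fun i => x (i + 1)))

lemma ccol_congr (k : ℕ) (x y : ℕ → ℕ) (h : ∀ i ≤ k, x i = y i) : ccol k x = ccol k y := by
  induction k generalizing x y with
  | zero => exact h 0 le_rfl
  | succ k ih =>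
    simp only [ccol]
    rw [ih x y (fun i hi => h i (by omega)), ih _ _ (fun i hi => h (i + 1) (by omega))]

lemma ccol_ne (k : ℕ) (x : ℕ → ℕ) (h : ∀ i ≤ k, x i ≠ x (i + 1)) :
    ccol k x ≠ ccol k (fun i => x (i + 1)) := by
  induction k generalizing x with
  | zero => exact h 0 le_rfl
  | succ k ih =>
    simp only [ccol]
    exact gcol_ne (ih x (fun i hi => h i (by omega)))

lemma tower_pos (k : ℕ) : 1 ≤ tower k 1 := by
  cases k with
  | zero => exact le_rfl
  | succ k => exact Nat.one_le_two_pow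

lemma ccol_lt (k j : ℕ) (x : ℕ → ℕ) (h : ∀ i, x i < 2 * tower (k + j) 1 + 4) :
    ccol k x < 2 * tower j 1 + 4 := by
  induction k generalizing j x with
  | zero => simpa [ccol] using h 0
  | succ k ih =>
    have hu := tower_pos j
    have hle : 2 * tower (j + 1) 1 + 4 ≤ 2 ^ (tower j 1 + 2) := by
      show 2 * 2 ^ tower j 1 + 4 ≤ _
      have : 2 ^ 1 ≤ 2 ^ tower j 1 := Nat.pow_le_pow_right (by norm_num) hu
      rw [pow_add]; omega
    have h' : ∀ i, x i < 2 * tower (k + (j + 1)) 1 + 4 := by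
      intro i
      have := h i
      rwa [show k + 1 + j = k + (j + 1) by ring] at this
    have h1 := (ih (j + 1) x h').trans_le hle
    have h2 := (ih (j + 1) (fun i => x (i + 1)) (fun i => h' _)).trans_le hle
    have := gcol_lt (by omega) h1 h2
    simp only [ccol]
    omega

/-- the sequence enumerating a finite set -/
noncomputable def enumF (P : Finset ℕ) (i : ℕ) : ℕ := (P.sort (· ≤ ·)).getD i 0

/-- the bad 2-coloring -/
noncomputable def badCol (k : ℕ) (P : Finset ℕ) : Fin 2 :=
  if ccol k (enumF P) < ccol k (fun i => enumF P (i + 1)) then 1 else 0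

lemma enumF_lt {P : Finset ℕ} {N : ℕ} (hN : 0 < N) (h : P ⊆ Finset.range N) (i : ℕ) :
    enumF P i < N := by
  unfold enumF
  by_cases hi : i < (P.sort (· ≤ ·)).length
  · rw [List.getD_eq_getElem _ _ hi]
    have := List.getElem_mem hi
    rw [Finset.mem_sort] at this
    exact Finset.mem_range.mp (h this)
  · rw [List.getD_eq_default _ _ (by omega)]
    exact hN

lemma enumF_ne {P : Finset ℕ} {i : ℕ} (hi : i + 1 < P.card) : enumF P i ≠ enumF P (i + 1) := by
  unfold enumF
  have hl : (P.sort (· ≤ ·)).length = P.card := Finset.length_sort _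
  rw [List.getD_eq_getElem _ _ (by omega), List.getD_eq_getElem _ _ (by omega)]
  intro he
  have := (List.Nodup.getElem_inj_iff (Finset.sort_nodup P (· ≤ ·))).mp he
  omega

lemma exists_window (Y : Finset ℕ) (i r : ℕ) (h : i + r ≤ Y.card) :
    ∃ P ⊆ Y, P.card = r ∧ ∀ j < r, enumF P j = enumF Y (i + j) := by
  set l := ((Y.sort (· ≤ ·)).drop i).take r with hl
  have hsub : l.Sublist (Y.sort (· ≤ ·)) := (List.take_sublist _ _).trans (List.drop_sublist _ _)
  have hnd : l.Nodup := hsub.nodup (Finset.sort_nodup _ _)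
  have hpw : l.Pairwise (· ≤ ·) := (Finset.pairwise_sort Y (· ≤ ·)).sublist hsub
  have hlen : l.length = r := by
    rw [hl, List.length_take, List.length_drop, Finset.length_sort]; omega
  refine ⟨l.toFinset, ?_, ?_, ?_⟩
  · intro x hx
    rw [List.mem_toFinset] at hx
    exact (Finset.mem_sort _).mp (hsub.subset hx)
  · rw [List.toFinset_card_of_nodup hnd, hlen]
  · intro j hj
    unfold enumF
    rw [(List.toFinset_sort (· ≤ ·) hnd).mpr hpw, hl]
    simp [List.getD_eq_getElem?_getD, hj]

lemma no_clique (k m n : ℕ) (hm : k + 2 + 6 ≤ m) (hn : n < tower k 1) :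
    ¬ HasMonoClique n (k + 2) m 2 (badCol k) := by
  rintro ⟨Y, hY, hc, c, hmono⟩
  set d : ℕ → ℕ := fun i => ccol k (fun j => enumF Y (i + j)) with hd
  have hYN : Y ⊆ Finset.range (2 * tower k 1 + 4) :=
    hY.trans (Finset.range_subset_range.mpr (by omega))
  have hlt : ∀ i, d i < 6 := by
    intro i
    have := ccol_lt k 0 (fun j => enumF Y (i + j)) (fun j => enumF_lt (by omega) hYN _)
    simpa [tower] using this
  have hne : ∀ i ≤ 6, d i ≠ d (i + 1) := by
    intro i hi
    have := ccol_ne k (fun j => enumF Y (i + j)) (fun j hj => by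
      have := enumF_ne (P := Y) (i := i + j) (by omega)
      simpa [add_assoc] using this)
    simp only [hd]
    have e : (fun j => enumF Y (i + 1 + j)) = fun j => enumF Y (i + (j + 1)) := by
      funext j
      congr 1; ring
    rw [e]
    exact this
  have hcol : ∀ i ≤ 6, (if d i < d (i + 1) then (1 : Fin 2) else 0) = c := by
    intro i hi
    obtain ⟨P, hP, hPc, hPe⟩ := exists_window Y i (k + 2) (by omega)
    rw [← hmono P hP hPc]
    unfold badCol
    have e1 : ccol k (enumF P) = d i := ccol_congr _ _ _ (fun j hj => hPe j (by omega))
    have e2 : ccol k (fun j => enumF P (j + 1)) = d (i + 1) :=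
      ccol_congr _ _ _ (fun j hj => by
        rw [hPe (j + 1) (by omega)]
        congr 1; ring)
    rw [e1, e2]
  have hup : (∀ i ≤ 6, d i < d (i + 1)) ∨ (∀ i ≤ 6, d (i + 1) < d i) := by
    by_cases hc1 : c = 1
    · left
      intro i hi
      by_contra h
      have := hcol i hi
      rw [if_neg h, hc1] at this
      exact absurd this (by decide)
    · right
      intro i hi
      have h1 := hne i hi
      by_contra h
      have := hcol i hi
      rw [if_pos (by omega)] at this
      exact hc1 this.symm
  have b0 := hlt 0
  have b6 := hlt 6
  rcases hup with h | h <;>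
  · have h0 := h 0 (by omega)
    have h1 := h 1 (by omega)
    have h2 := h 2 (by omega)
    have h3 := h 3 (by omega)
    have h4 := h 4 (by omega)
    have h5 := h 5 (by omega)
    simp only [Nat.reduceAdd] at *
    omega

lemma ramsey_ge (k m : ℕ) (hm : k + 2 + 6 ≤ m) : tower k 1 ≤ ramsey (k + 2) m 2 := by
  have hne : {n | ∀ φ : Finset ℕ → Fin 2, HasMonoClique n (k + 2) m 2 φ}.Nonempty := by
    obtain ⟨M, -, hR, -⟩ := ramP_tower m (k + 2 + 3) (by omega) (k + 2) le_rfl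
    exact ⟨M, fun φ => mem_ramsey_of_ramP hR φ⟩
  have hmem := Nat.sInf_mem hne
  by_contra! hlt
  exact no_clique k m _ hm hlt (hmem (badCol k))

/-! ### Towers -/

lemma tower_mono (k : ℕ) {x y : ℕ} (h : x ≤ y) : tower k x ≤ tower k y := by
  induction k with
  | zero => exact h
  | succ k ih => exact Nat.pow_le_pow_right (by norm_num) ih

lemma tower_add (a b x : ℕ) : tower (a + b) x = tower a (tower b x) := by
  induction a with
  | zero => simp [tower]
  | succ a ih =>
    rw [show a + 1 + b = (a + b) + 1 by ring]
    simp only [tower, ih]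

lemma tower_ge (j : ℕ) : j + 1 ≤ tower j 1 := by
  induction j with
  | zero => exact le_rfl
  | succ j ih =>
    have : tower j 1 < 2 ^ tower j 1 := Nat.lt_two_pow_self
    show _ ≤ 2 ^ tower j 1
    omega

lemma base_le (m n : ℕ) (h : 2 * (m + 5) ≤ 2 ^ n) :
    (m + 3) * m ^ (m + 3) + (m + 3) ≤ tower (n + 3) 1 := by
  have h1 : (m + 3) * m ^ (m + 3) + (m + 3) ≤ (m + 5) ^ (m + 5) := by
    have e1 : m ^ (m + 3) ≤ (m + 5) ^ (m + 3) := Nat.pow_le_pow_left (by omega) _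
    have e2 : 1 ≤ (m + 5) ^ (m + 3) := Nat.one_le_pow _ _ (by omega)
    calc (m + 3) * m ^ (m + 3) + (m + 3) ≤ (m + 3) * (m + 5) ^ (m + 3) + (m + 3) * (m + 5) ^ (m + 3) := by
          nlinarith
      _ ≤ (m + 5) ^ (m + 3) * ((m + 5) * (m + 5)) := by
          rw [← add_mul, mul_comm]
          exact Nat.mul_le_mul_left _ (by nlinarith)
      _ = (m + 5) ^ (m + 5) := by ring
  have h2 : m + 5 ≤ 2 ^ (m + 5) := Nat.lt_two_pow_self.le
  have h3 : (m + 5) ^ (m + 5) ≤ 2 ^ ((m + 5) * (m + 5)) := by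
    rw [pow_mul]; exact Nat.pow_le_pow_left h2 _
  have h4 : (m + 5) * (m + 5) ≤ 2 ^ (2 * (m + 5)) := by
    rw [two_mul, pow_add]; exact Nat.mul_le_mul h2 h2
  have h5 : 2 ^ n ≤ tower (n + 1) 1 := by
    show _ ≤ 2 ^ tower n 1
    exact Nat.pow_le_pow_right (by norm_num) (by have := tower_ge n; omega)
  refine h1.trans (h3.trans ?_)
  show _ ≤ 2 ^ 2 ^ tower (n + 1) 1
  refine Nat.pow_le_pow_right (by norm_num) (h4.trans ?_)
  exact Nat.pow_le_pow_right (by norm_num) (h.trans h5)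

lemma lin_le_pow (C : ℝ) : ∃ n₀ : ℕ, ∀ n : ℕ, n₀ ≤ n → C * (n + 1) ≤ (2 : ℝ) ^ n := by
  obtain ⟨N, hN⟩ := exists_nat_ge (8 * |C|)
  refine ⟨N + 1, fun n hn => ?_⟩
  have hsq : ∀ n : ℕ, n ^ 2 ≤ 4 * 2 ^ n := by
    intro n
    induction n with
    | zero => norm_num
    | succ n ih =>
      rcases Nat.lt_or_ge n 3 with h | h
      · interval_cases n <;> norm_num
      · rw [pow_succ 2 n]; nlinarith
  have h1 : ((n : ℝ)) ^ 2 ≤ 4 * 2 ^ n := by exact_mod_cast hsq n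
  have h2 : (N : ℝ) + 1 ≤ n := by exact_mod_cast hn
  have h3 := le_abs_self C
  have h4 := abs_nonneg C
  have h5 : C * (n + 1) ≤ |C| * (n + 1) := by nlinarith
  have h6 : |C| * (n + 1) ≤ |C| * (2 * n) := by nlinarith
  nlinarith

/-- For every `ε > 0` there is `r₀` such that for all `r ≥ r₀` and all `m`
with `(1+ε)r ≤ m ≤ (2-ε)r`, we have `t_{⌊εr/2⌋}(D_r(m)) ≤ R_r(m)`. -/
theorem tower_daisyRamsey_le_ramsey (ε : ℝ) (hε : 0 < ε) :
    ∃ r₀ : ℕ, ∀ r : ℕ, r₀ ≤ r → ∀ m : ℕ,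
      (1 + ε) * (r : ℝ) ≤ (m : ℝ) → (m : ℝ) ≤ (2 - ε) * (r : ℝ) →
      tower ⌊ε * (r : ℝ) / 2⌋₊ (daisyRamsey r m 2) ≤ ramsey r m 2 := by
  obtain ⟨n₀, hn₀⟩ := lin_le_pow (48 / ε + 10)
  obtain ⟨r₀, hr₀⟩ := exists_nat_ge (2 * (n₀ + 12) / ε)
  refine ⟨r₀, ?_⟩
  intro r hr m h1 h2
  have hr' : 2 * ((n₀ : ℝ) + 12) ≤ ε * r := by
    have : (r₀ : ℝ) ≤ r := by exact_mod_cast hr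
    have h := hr₀.trans this
    rw [div_le_iff₀ hε] at h
    linarith
  set k := ⌊ε * (r : ℝ) / 2⌋₊ with hk
  have hk1 : (k : ℝ) ≤ ε * r / 2 := Nat.floor_le (by positivity)
  have hn0 : (0 : ℝ) ≤ n₀ := Nat.cast_nonneg _
  have hrm : r + 6 ≤ m := by
    have : (r : ℝ) + 6 ≤ m := by linarith
    exact_mod_cast this
  have hm2 : m ≤ 2 * r := by
    have : (m : ℝ) ≤ 2 * r := by linarith
    exact_mod_cast this
  have hslack : m + k + n₀ + 5 ≤ 2 * r := by
    have : (m : ℝ) + k + n₀ + 5 ≤ 2 * r := by linarith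
    exact_mod_cast this
  obtain ⟨s, rfl⟩ : ∃ s, m = r + s := ⟨m - r, by omega⟩
  obtain ⟨n, hn⟩ : ∃ n, r = k + s + n + 5 := ⟨r - k - s - 5, by omega⟩
  have hnn : n₀ ≤ n := by omega
  have hnr : ε * r / 2 ≤ n + 5 := by
    have e1 : (r : ℝ) = k + s + n + 5 := by exact_mod_cast hn
    push_cast at h2
    linarith
  have hpow : 2 * ((r + s) + 5) ≤ 2 ^ n := by
    have h3 := hn₀ n hnn
    have h4 : (r : ℝ) ≤ 2 / ε * (n + 5) := by
      rw [div_mul_eq_mul_div, le_div_iff₀ hε]; linarith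
    have h5 : (r : ℝ) + s ≤ 2 * r := by exact_mod_cast hm2
    have h6 : 2 * (((r : ℝ) + s) + 5) ≤ 2 ^ n := by
      refine le_trans ?_ h3
      have h7 : (0 : ℝ) < 1 / ε := by positivity
      have h8 : 48 / ε = 48 * (1 / ε) := by ring
      have h9 : 2 / ε = 2 * (1 / ε) := by ring
      rw [h8]
      rw [h9] at h4
      have hnp : (0 : ℝ) ≤ n := Nat.cast_nonneg _
      nlinarith [mul_nonneg h7.le hnp]
    exact_mod_cast h6
  obtain ⟨M, hM, hR, hb⟩ := ramP_tower (r + s) (r + s + 3) (by omega) s (by omega)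
  have hD : daisyRamsey r (r + s) 2 ≤ tower s (tower (n + 3) 1) := by
    refine (daisy_le_of_ramP hR rfl).trans (le_trans ?_ (hb.trans (tower_mono s (base_le _ n hpow))))
    have : M ≤ M ^ (r + s + 3) := Nat.le_self_pow (by omega) M
    nlinarith
  have hge := ramsey_ge (k + (s + (n + 3))) (r + s) (by omega)
  rw [show k + (s + (n + 3)) + 2 = r by omega] at hge
  refine le_trans (tower_mono k hD) (le_trans (le_of_eq ?_) hge)
  rw [tower_add k, tower_add s]
end

section
/- There exists a positive constant c such that: for every real ε > 0 there exists an integer r₀ such that for every integer r ≥ r₀ and every integer s with ε·r ≤ s ≤ (1−ε)·r, one has D_r(r+s) ≤ t_{s−1}(c·(r+s)) < t_{r−6}(10) ≤ R_r(r+s). -/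
/-- The tower function on reals: `t_0(x) = x`, `t_{i+1}(x) = 2 ^ t_i(x)`. -/
noncomputable def rtower : ℕ → ℝ → ℝ
  | 0, x => x
  | i + 1, x => (2 : ℝ) ^ rtower i x

/-! ### Upper bound -/

/-- Ramsey property for arbitrary ground sets. -/
def RProp (N k m : ℕ) : Prop :=
  ∀ A : Finset ℕ, N ≤ A.card → ∀ φ : Finset ℕ → Fin 2, ∃ Y ⊆ A, Y.card = m ∧
    ∃ c : Fin 2, ∀ P ⊆ Y, P.card = k → φ P = c

theorem rprop_one (m : ℕ) : RProp (2 * m) 1 m := by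
  intro A hA φ
  obtain ⟨c, hc⟩ : ∃ c : Fin 2, m ≤ (A.filter (fun x => φ {x} = c)).card := by
    by_contra! h
    have h1 := Finset.card_eq_sum_card_fiberwise (f := fun x => φ {x}) (s := A)
      (t := Finset.univ) (fun _ _ => Finset.mem_coe.2 (Finset.mem_univ _))
    rw [Fin.sum_univ_two] at h1
    have h2 := h 0
    have h3 := h 1
    omega
  obtain ⟨Y, hY, hYc⟩ := Finset.exists_subset_card_eq hc
  refine ⟨Y, hY.trans (Finset.filter_subset _ _), hYc, c, ?_⟩
  intro P hP hP1
  obtain ⟨x, rfl⟩ := Finset.card_eq_one.1 hP1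
  have := hY (hP (Finset.mem_singleton_self x))
  exact (Finset.mem_filter.1 this).2

/-- `A` is end-homogeneous with reservoir `S`. -/
def EH (φ : Finset ℕ → Fin 2) (k : ℕ) (A S : Finset ℕ) : Prop :=
  (∀ a ∈ A, ∀ y ∈ S, a < y) ∧
  ∀ B ⊆ A, B.card = k + 1 → ∀ y, y ∈ A ∨ y ∈ S → (∀ b ∈ B, b < y) → ∀ z ∈ S,
    φ (insert y B) = φ (insert z B)

theorem eh_step (φ : Finset ℕ → Fin 2) (k D n : ℕ) (A S : Finset ℕ) (h : EH φ k A S)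
    (hD : 1 ≤ D) (hA : A.card.choose k ≤ D) (hS : 2 ^ (D * (n + 1)) ≤ S.card) :
    ∃ A' S' : Finset ℕ, A' ⊆ A ∪ S ∧ S' ⊆ S ∧ A'.card = A.card + 1 ∧ EH φ k A' S' ∧
      2 ^ (D * n) ≤ S'.card := by
  have hne : S.Nonempty := by
    rw [← Finset.card_pos]
    exact lt_of_lt_of_le (by positivity) hS
  set x := S.min' hne with hx
  have hxS : x ∈ S := S.min'_mem hne
  have hxmin : ∀ y ∈ S, x ≤ y := fun y hy => S.min'_le y hy
  have hxA : x ∉ A := fun hxa => lt_irrefl x (h.1 x hxa x hxS)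
  let cl : ℕ → Finset (Finset ℕ) := fun y =>
    (A.powersetCard k).filter (fun C => φ (insert y (insert x C)) = 0)
  have hmaps : ∀ y ∈ S.erase x, cl y ∈ (A.powersetCard k).powerset := by
    intro y _
    exact Finset.mem_powerset.2 (Finset.filter_subset _ _)
  have hcard : ((A.powersetCard k).powerset).card * (2 ^ (D * n) - 1) < (S.erase x).card := by
    rw [Finset.card_powerset, Finset.card_powersetCard, Finset.card_erase_of_mem hxS]
    have h1 : 2 ^ (A.card.choose k) ≤ 2 ^ D := Nat.pow_le_pow_right (by norm_num) hA
    have h2 : 2 ^ (A.card.choose k) * (2 ^ (D * n) - 1) ≤ 2 ^ D * (2 ^ (D * n) - 1) :=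
      Nat.mul_le_mul_right _ h1
    have h3 : 2 ^ D * (2 ^ (D * n) - 1) + 2 ^ D = 2 ^ (D * (n + 1)) := by
      have : 1 ≤ 2 ^ (D * n) := Nat.one_le_two_pow
      obtain ⟨q, hq⟩ := Nat.exists_eq_add_of_le this
      rw [Nat.mul_succ, pow_add, hq, Nat.add_sub_cancel_left]; ring
    have h4 : 2 ^ 1 ≤ 2 ^ D := Nat.pow_le_pow_right (by norm_num) hD
    omega
  obtain ⟨t, -, ht⟩ := Finset.exists_lt_card_fiber_of_mul_lt_card_of_maps_to hmaps hcard
  have hS'S : (S.erase x).filter (fun y => cl y = t) ⊆ S :=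
    (Finset.filter_subset _ _).trans (Finset.erase_subset _ _)
  refine ⟨insert x A, (S.erase x).filter (fun y => cl y = t), ?_, hS'S, ?_, ⟨?_, ?_⟩, ?_⟩
  · intro y hy
    rcases Finset.mem_insert.1 hy with rfl | hy
    · exact Finset.mem_union_right _ hxS
    · exact Finset.mem_union_left _ hy
  · exact Finset.card_insert_of_notMem hxA
  · intro a ha y hy
    rcases Finset.mem_insert.1 ha with rfl | ha
    · have h1 := Finset.mem_erase.1 (Finset.mem_filter.1 hy).1
      exact lt_of_le_of_ne (hxmin y h1.2) (Ne.symm h1.1)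
    · exact h.1 a ha y (hS'S hy)
  · intro B hB hBk y hy hlt z hz
    by_cases hxB : x ∈ B
    · have hxy := hlt x hxB
      have hyS : y ∈ (S.erase x).filter (fun y => cl y = t) := by
        rcases hy with hy | hy
        · rcases Finset.mem_insert.1 hy with h1 | h1
          · omega
          · have := h.1 y h1 x hxS
            omega
        · exact hy
      have hC : B.erase x ∈ A.powersetCard k := by
        rw [Finset.mem_powersetCard]
        constructor
        · intro b hb
          rw [Finset.mem_erase] at hb
          exact (Finset.mem_insert.1 (hB hb.2)).resolve_left hb.1
        · rw [Finset.card_erase_of_mem hxB, hBk]; rfl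
      have e1 : cl y = cl z := (Finset.mem_filter.1 hyS).2.trans (Finset.mem_filter.1 hz).2.symm
      have e2 : B.erase x ∈ cl y ↔ B.erase x ∈ cl z := by rw [e1]
      simp only [cl, Finset.mem_filter, hC, true_and, Finset.insert_erase hxB] at e2
      generalize φ (insert y B) = p at *
      generalize φ (insert z B) = q at *
      omega
    · have hBA : B ⊆ A := by
        intro b hb
        exact (Finset.mem_insert.1 (hB hb)).resolve_left (fun e => hxB (e ▸ hb))
      refine h.2 B hBA hBk y ?_ hlt z (hS'S hz)
      rcases hy with hy | hy
      · rcases Finset.mem_insert.1 hy with h1 | h1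
        · right; rw [h1]; exact hxS
        · left; exact h1
      · right; exact hS'S hy
  · omega

theorem eh_iter (φ : Finset ℕ → Fin 2) (k N : ℕ) (hN : 1 ≤ N) (S₀ : Finset ℕ)
    (hS : 2 ^ (N ^ (k + 1)) ≤ S₀.card) (i : ℕ) (hi : i ≤ N) :
    ∃ A S : Finset ℕ, A ⊆ S₀ ∧ S ⊆ S₀ ∧ A.card = i ∧ EH φ k A S ∧
      2 ^ (N ^ k * (N - i)) ≤ S.card := by
  induction i with
  | zero =>
    refine ⟨∅, S₀, by simp, subset_rfl, rfl, ⟨by simp, ?_⟩, ?_⟩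
    · intro B hB hBk
      rw [Finset.subset_empty.1 hB] at hBk
      simp at hBk
    · simpa [pow_succ] using hS
  | succ i ih =>
    obtain ⟨A, S, hA, hS, hAc, hE, hSc⟩ := ih (by omega)
    have h1 : N - i = (N - (i + 1)) + 1 := by omega
    rw [h1] at hSc
    have hch : A.card.choose k ≤ N ^ k :=
      (Nat.choose_le_pow _ _).trans (Nat.pow_le_pow_left (by omega) _)
    obtain ⟨A', S', h2, h3, h4, h5, h6⟩ := eh_step φ k (N ^ k) (N - (i + 1)) A S hE
      (Nat.one_le_pow _ _ hN) hch hSc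
    exact ⟨A', S', h2.trans (Finset.union_subset hA hS), h3.trans hS, by omega, h5, h6⟩

theorem rprop_step (N k m : ℕ) (hN : 1 ≤ N) (h : RProp N (k + 1) m) :
    RProp (2 ^ (N ^ (k + 1))) (k + 2) m := by
  intro S₀ hS₀ φ
  obtain ⟨A, S, hA, hS, hAc, hE, hSc⟩ := eh_iter φ k N hN S₀ hS₀ N le_rfl
  have hne : S.Nonempty := by
    rw [← Finset.card_pos]
    exact lt_of_lt_of_le (by positivity) hSc
  obtain ⟨z, hz⟩ := hne
  obtain ⟨Y, hY, hYc, c, hc⟩ := h A hAc.ge (fun B => φ (insert z B))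
  refine ⟨Y, hY.trans hA, hYc, c, ?_⟩
  intro P hP hPk
  have hPne : P.Nonempty := by rw [← Finset.card_pos]; omega
  have hmem := P.max'_mem hPne
  have hBc : (P.erase (P.max' hPne)).card = k + 1 := by
    rw [Finset.card_erase_of_mem hmem, hPk]; rfl
  have hBY : P.erase (P.max' hPne) ⊆ Y := (Finset.erase_subset _ _).trans hP
  have h1 := hE.2 _ (hBY.trans hY) hBc (P.max' hPne) (Or.inl (hY (hP hmem))) ?_ z hz
  · rw [Finset.insert_erase hmem] at h1
    rw [h1]
    exact hc _ hBY hBc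
  · intro b hb
    exact P.lt_max'_of_mem_erase_max' hPne hb

/-- Numerical upper bounds. -/
def ubd (m : ℕ) : ℕ → ℕ
  | 0 => 2 * m
  | k + 1 => 2 ^ (ubd m k ^ (k + 1))

theorem ubd_pos (m : ℕ) (hm : 1 ≤ m) (k : ℕ) : 1 ≤ ubd m k := by
  cases k with
  | zero => simp only [ubd]; omega
  | succ k => exact Nat.one_le_two_pow

theorem rprop_ubd (m : ℕ) (hm : 1 ≤ m) (k : ℕ) : RProp (ubd m k) (k + 1) m := by
  induction k with
  | zero => exact rprop_one m
  | succ k ih => exact rprop_step _ k m (ubd_pos m hm k) ih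

/-- Natural number tower. -/
def ntower : ℕ → ℕ → ℕ
  | 0, x => x
  | i + 1, x => 2 ^ ntower i x

theorem rtower_cast (i n : ℕ) : rtower i (n : ℝ) = (ntower i n : ℝ) := by
  induction i with
  | zero => rfl
  | succ i ih =>
    simp only [rtower, ntower, ih]
    rw [Real.rpow_natCast]; push_cast; rfl

theorem ubd_aux (m : ℕ) (hm : 1 ≤ m) (k : ℕ) (hk : k + 1 ≤ m) :
    (k + 2) * ubd m k ^ (k + 1) + (m + 4) ≤ ntower k (10 * m) := by
  induction k with
  | zero => simp only [ubd, ntower, Nat.zero_add, pow_one]; omega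
  | succ k ih =>
    have ih := ih (by omega)
    set b := (k + 2) * ubd m k ^ (k + 1) with hb
    have e : ubd m (k + 1) ^ (k + 1 + 1) = 2 ^ b := by
      simp only [ubd]
      rw [← pow_mul, hb, mul_comm]
    rw [e]
    have h1 : 2 * m + 6 ≤ 2 ^ (m + 4) := by
      have : m < 2 ^ m := Nat.lt_two_pow_self
      rw [pow_add]; omega
    have h2 : 1 ≤ 2 ^ b := Nat.one_le_two_pow
    calc (k + 1 + 2) * 2 ^ b + (m + 4) ≤ (k + 1 + 2) * 2 ^ b + (m + 4) * 2 ^ b := by nlinarith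
      _ = (k + m + 7) * 2 ^ b := by ring
      _ ≤ 2 ^ (m + 4) * 2 ^ b := Nat.mul_le_mul_right _ (by omega)
      _ = 2 ^ (b + (m + 4)) := by rw [← pow_add, add_comm]
      _ ≤ 2 ^ ntower k (10 * m) := Nat.pow_le_pow_right (by norm_num) ih
      _ = ntower (k + 1) (10 * m) := rfl

theorem ubd_le (m : ℕ) (hm : 1 ≤ m) (k : ℕ) (hk : k + 1 ≤ m) :
    ubd m k ≤ ntower k (10 * m) := by
  refine le_trans ?_ (ubd_aux m hm k hk)
  have h1 : ubd m k ≤ ubd m k ^ (k + 1) := Nat.le_self_pow (by omega) _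
  nlinarith

theorem daisy_le (N r s : ℕ) (h : RProp N s (r + s)) : daisyRamsey r (r + s) 2 ≤ N := by
  apply Nat.sInf_le
  intro φ
  obtain ⟨Y, hY, hYc, c, hc⟩ := h (Finset.range N) (by simp) (fun Q => φ (Finset.range N \ Q))
  refine ⟨Finset.range N \ Y, Y, Finset.sdiff_subset, hY, Finset.sdiff_disjoint, hYc, c, ?_⟩
  intro P hP hPr
  have h1 := hc (Y \ P) Finset.sdiff_subset (by rw [Finset.card_sdiff_of_subset hP]; omega)
  have h2 : Finset.range N \ (Y \ P) = Finset.range N \ Y ∪ P := by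
    ext x
    have a1 := @hY x
    have a2 := @hP x
    simp only [Finset.mem_sdiff, Finset.mem_union]
    tauto
  rw [← h2]
  exact h1

/-! ### Lower bound -/

/-- Drop the minimum. -/
def dmin (S : Finset ℕ) : Finset ℕ := S.filter (fun x => ∃ y ∈ S, y < x)

/-- Drop the maximum. -/
def dmax (S : Finset ℕ) : Finset ℕ := S.filter (fun x => ∃ y ∈ S, x < y)

theorem dmin_subset (S : Finset ℕ) : dmin S ⊆ S := Finset.filter_subset _ _

theorem dmax_subset (S : Finset ℕ) : dmax S ⊆ S := Finset.filter_subset _ _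

theorem mem_dmin (S : Finset ℕ) (x : ℕ) : x ∈ dmin S ↔ x ∈ S ∧ ∃ y ∈ S, y < x :=
  Finset.mem_filter

theorem mem_dmax (S : Finset ℕ) (x : ℕ) : x ∈ dmax S ↔ x ∈ S ∧ ∃ y ∈ S, x < y :=
  Finset.mem_filter

theorem dmin_dmax_comm (S : Finset ℕ) : dmin (dmax S) = dmax (dmin S) := by
  ext x
  simp only [mem_dmin, mem_dmax]
  constructor
  · rintro ⟨⟨h1, y, hy, hxy⟩, z, ⟨hz, -⟩, hzx⟩
    exact ⟨⟨h1, z, hz, hzx⟩, y, ⟨hy, x, h1, hxy⟩, hxy⟩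
  · rintro ⟨⟨h1, y, hy, hxy⟩, z, ⟨hz, -⟩, hzx⟩
    exact ⟨⟨h1, z, hz, hzx⟩, y, ⟨hy, x, h1, hxy⟩, hxy⟩

theorem card_dmin (S : Finset ℕ) : (dmin S).card = S.card - 1 := by
  rcases S.eq_empty_or_nonempty with rfl | h
  · rfl
  · have : dmin S = S.erase (S.min' h) := by
      ext x
      simp only [dmin, Finset.mem_filter, Finset.mem_erase]
      constructor
      · rintro ⟨hx, y, hy, hyx⟩
        refine ⟨?_, hx⟩
        have := S.min'_le y hy
        omega
      · rintro ⟨hne, hx⟩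
        exact ⟨hx, _, S.min'_mem h, lt_of_le_of_ne (S.min'_le x hx) (Ne.symm hne)⟩
    rw [this, Finset.card_erase_of_mem (S.min'_mem h)]

theorem card_dmax (S : Finset ℕ) : (dmax S).card = S.card - 1 := by
  rcases S.eq_empty_or_nonempty with rfl | h
  · rfl
  · have : dmax S = S.erase (S.max' h) := by
      ext x
      simp only [dmax, Finset.mem_filter, Finset.mem_erase]
      constructor
      · rintro ⟨hx, y, hy, hyx⟩
        refine ⟨?_, hx⟩
        have := S.le_max' y hy
        omega
      · rintro ⟨hne, hx⟩
        exact ⟨hx, _, S.max'_mem h, lt_of_le_of_ne (S.le_max' x hx) hne⟩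
    rw [this, Finset.card_erase_of_mem (S.max'_mem h)]

/-- The shift graph on `j`-subsets of `[N]` is properly `a`-colorable. -/
def ShiftCol (j a N : ℕ) : Prop :=
  ∃ f : Finset ℕ → ℕ,
    (∀ S ⊆ Finset.range N, S.card = j → f S < a) ∧
    ∀ T ⊆ Finset.range N, T.card = j + 1 → f (dmin T) ≠ f (dmax T)

theorem shiftCol_one (N : ℕ) : ShiftCol 1 N N := by
  refine ⟨fun S => S.sup id, ?_, ?_⟩
  · intro S hS hS1
    obtain ⟨x, rfl⟩ := Finset.card_eq_one.1 hS1
    have := hS (Finset.mem_singleton_self x)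
    simpa using this
  · intro T hT hT2
    obtain ⟨x, hx⟩ := Finset.card_eq_one.1 (by rw [card_dmin, hT2] : (dmin T).card = 1)
    obtain ⟨y, hy⟩ := Finset.card_eq_one.1 (by rw [card_dmax, hT2] : (dmax T).card = 1)
    rw [hx, hy]
    have h1 : x ∈ dmin T := by rw [hx]; simp
    have h2 : y ∈ dmax T := by rw [hy]; simp
    have h3 : x ∉ dmax T := by
      intro h3
      have h4 : x ∈ dmin (dmax T) := by
        simp only [mem_dmin, mem_dmax] at h1 h3 ⊢
        obtain ⟨hx1, z, hz, hzx⟩ := h1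
        exact ⟨h3, z, ⟨hz, x, hx1, hzx⟩, hzx⟩
      have h5 : (dmin (dmax T)).card = 0 := by rw [card_dmin, card_dmax, hT2]
      rw [Finset.card_eq_zero] at h5
      rw [h5] at h4
      simp at h4
    simp only [Finset.sup_singleton, id]
    rintro rfl
    exact h3 h2

theorem shiftCol_step (j a N : ℕ) (h : ShiftCol j (a.choose (a / 2)) N) :
    ShiftCol (j + 1) a N := by
  classical
  obtain ⟨f, hf1, hf2⟩ := h
  have hc : ((Finset.range a).powersetCard (a / 2)).card = a.choose (a / 2) := by
    rw [Finset.card_powersetCard, Finset.card_range]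
  let g := ((Finset.range a).powersetCard (a / 2)).equivFinOfCardEq hc
  let G : ℕ → Finset ℕ := fun i =>
    if hi : i < a.choose (a / 2) then (g.symm ⟨i, hi⟩ : Finset ℕ) else ∅
  have hG : ∀ i, i < a.choose (a / 2) → G i ⊆ Finset.range a ∧ (G i).card = a / 2 := by
    intro i hi
    have := (g.symm ⟨i, hi⟩).2
    simp only [G, hi, dif_pos]
    exact Finset.mem_powersetCard.1 this
  have hinj : ∀ i i', i < a.choose (a / 2) → i' < a.choose (a / 2) → G i = G i' → i = i' := by
    intro i i' hi hi' he
    simp only [G, hi, hi', dif_pos] at he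
    have := g.symm.injective (Subtype.ext he)
    simpa using this
  have key : ∀ T : Finset ℕ, ∃ p : ℕ, T ⊆ Finset.range N → T.card = j + 1 →
      p ∈ G (f (dmin T)) ∧ p ∉ G (f (dmax T)) ∧ p < a := by
    intro T
    by_cases hT : T ⊆ Finset.range N ∧ T.card = j + 1
    · have l1 := hf1 (dmin T) ((dmin_subset T).trans hT.1) (by rw [card_dmin, hT.2]; rfl)
      have l2 := hf1 (dmax T) ((dmax_subset T).trans hT.1) (by rw [card_dmax, hT.2]; rfl)
      have hns : ¬ G (f (dmin T)) ⊆ G (f (dmax T)) := by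
        intro hs
        have := Finset.eq_of_subset_of_card_le hs (by rw [(hG _ l1).2, (hG _ l2).2])
        exact hf2 T hT.1 hT.2 (hinj _ _ l1 l2 this)
      obtain ⟨p, hp1, hp2⟩ := Finset.not_subset.1 hns
      exact ⟨p, fun _ _ => ⟨hp1, hp2, Finset.mem_range.1 ((hG _ l1).1 hp1)⟩⟩
    · exact ⟨0, fun h1 h2 => absurd ⟨h1, h2⟩ hT⟩
  choose F hF using key
  refine ⟨F, fun S hS hSc => (hF S hS hSc).2.2, ?_⟩
  intro U hU hUc he
  have h1 := hF (dmin U) ((dmin_subset U).trans hU) (by rw [card_dmin, hUc]; rfl)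
  have h2 := hF (dmax U) ((dmax_subset U).trans hU) (by rw [card_dmax, hUc]; rfl)
  apply h1.2.1
  rw [he, ← dmin_dmax_comm]
  exact h2.1

/-- Iterated central binomials. -/
def lbd : ℕ → ℕ
  | 0 => 20
  | i + 1 => (lbd i).choose (lbd i / 2)

theorem shiftCol_iter (i j N : ℕ) (h : ShiftCol j (lbd i) N) : ShiftCol (j + i) 20 N := by
  induction i generalizing j with
  | zero => exact h
  | succ i ih =>
    have := ih (j + 1) (shiftCol_step j (lbd i) N h)
    rwa [show j + (i + 1) = j + 1 + i by ring]

theorem ntower_ge (i x : ℕ) : x + i ≤ ntower i x := by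
  induction i with
  | zero => exact le_rfl
  | succ i ih =>
    have : ntower i x < 2 ^ ntower i x := Nat.lt_two_pow_self
    simp only [ntower]; omega

theorem central_ge (t a : ℕ) (ht : 10 ≤ t) (h : 2 * t ≤ a) : 2 * 2 ^ t ≤ a.choose (a / 2) := by
  have h1 : (2 * t).choose t ≤ a.choose (a / 2) :=
    (Nat.choose_le_choose t h).trans (Nat.choose_le_middle t a)
  refine le_trans ?_ h1
  have h2 := Nat.four_pow_le_two_mul_self_mul_centralBinom t (by omega)
  rw [Nat.centralBinom_eq_two_mul_choose] at h2
  have h3 : 4 * t ≤ 2 ^ t := by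
    clear h h1 h2
    induction t, ht using Nat.le_induction with
    | base => norm_num
    | succ n hn ih => rw [pow_succ]; omega
  have h4 : (4 : ℕ) ^ t = 2 ^ t * 2 ^ t := by rw [← mul_pow]; norm_num
  rw [h4] at h2
  have h5 : (2 * t) * (2 * 2 ^ t) ≤ (2 * t) * (2 * t).choose t := by nlinarith
  exact Nat.le_of_mul_le_mul_left h5 (by omega)

theorem lbd_ge (i : ℕ) : 2 * ntower i 10 ≤ lbd i := by
  induction i with
  | zero => simp [ntower, lbd]
  | succ i ih =>
    exact central_ge _ _ (by have := ntower_ge i 10; omega) ih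

theorem ntower_mono_left (i d x : ℕ) : ntower i x ≤ ntower (i + d) x := by
  induction d with
  | zero => exact le_rfl
  | succ d ih =>
    refine ih.trans ?_
    have : ntower (i + d) x < 2 ^ ntower (i + d) x := Nat.lt_two_pow_self
    exact this.le

theorem card_dmin_iter (a : ℕ) (S : Finset ℕ) : (dmin^[a] S).card = S.card - a := by
  induction a with
  | zero => rfl
  | succ a ih => rw [Function.iterate_succ_apply', card_dmin, ih]; omega

theorem card_dmax_iter (a : ℕ) (S : Finset ℕ) : (dmax^[a] S).card = S.card - a := by
  induction a with
  | zero => rfl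
  | succ a ih => rw [Function.iterate_succ_apply', card_dmax, ih]; omega

theorem dmin_iter_subset (a : ℕ) (S : Finset ℕ) : dmin^[a] S ⊆ S := by
  induction a with
  | zero => exact subset_rfl
  | succ a ih => rw [Function.iterate_succ_apply']; exact (dmin_subset _).trans ih

theorem dmax_iter_subset (a : ℕ) (S : Finset ℕ) : dmax^[a] S ⊆ S := by
  induction a with
  | zero => exact subset_rfl
  | succ a ih => rw [Function.iterate_succ_apply']; exact (dmax_subset _).trans ih

theorem dmax_dmin_iter (a : ℕ) (S : Finset ℕ) : dmax (dmin^[a] S) = dmin^[a] (dmax S) := by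
  induction a with
  | zero => rfl
  | succ a ih =>
    rw [Function.iterate_succ_apply', ← dmin_dmax_comm, ih, Function.iterate_succ_apply']

theorem no_clique_s5 (j N s : ℕ) (hs : 20 ≤ s) (h : ShiftCol j 20 N) :
    ∃ φ : Finset ℕ → Fin 2, ∀ n ≤ N, ¬ HasMonoClique n (j + 1) (j + 1 + s) 2 φ := by
  obtain ⟨f, hf1, hf2⟩ := h
  refine ⟨fun T => if f (dmax T) < f (dmin T) then 0 else 1, ?_⟩
  rintro n hn ⟨Y, hY, hYc, c, hc⟩
  have hYN : Y ⊆ Finset.range N := hY.trans (Finset.range_subset_range.2 hn)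
  let W : ℕ → ℕ := fun a => f (dmin^[a] (dmax^[s + 1 - a] Y))
  have hW : ∀ a ≤ s + 1, W a < 20 := by
    intro a ha
    apply hf1
    · exact ((dmin_iter_subset _ _).trans (dmax_iter_subset _ _)).trans hYN
    · rw [card_dmin_iter, card_dmax_iter, hYc]; omega
  have hstep : ∀ a ≤ s, W a ≠ W (a + 1) ∧ ((if W a < W (a + 1) then 0 else 1 : Fin 2) = c) := by
    intro a ha
    have hsub : dmin^[a] (dmax^[s - a] Y) ⊆ Y :=
      (dmin_iter_subset _ _).trans (dmax_iter_subset _ _)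
    have hcard : (dmin^[a] (dmax^[s - a] Y)).card = j + 1 := by
      rw [card_dmin_iter, card_dmax_iter, hYc]; omega
    have e1 : f (dmax (dmin^[a] (dmax^[s - a] Y))) = W a := by
      simp only [W]
      rw [dmax_dmin_iter, ← Function.iterate_succ_apply' dmax,
        show (s - a).succ = s + 1 - a by omega]
    have e2 : f (dmin (dmin^[a] (dmax^[s - a] Y))) = W (a + 1) := by
      simp only [W]
      rw [← Function.iterate_succ_apply' dmin, show s + 1 - (a + 1) = s - a by omega]
    have h1 := hf2 _ (hsub.trans hYN) hcard
    have h2 := hc _ hsub hcard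
    simp only [e1, e2] at h1 h2
    exact ⟨h1.symm, h2⟩
  have hc01 : c = 0 ∨ c = 1 := by omega
  rcases hc01 with rfl | rfl
  · have : ∀ a ≤ s + 1, a ≤ W a := by
      intro a
      induction a with
      | zero => intro _; omega
      | succ a ih =>
        intro ha
        have h1 := ih (by omega)
        have h2 := (hstep a (by omega)).2
        by_cases hlt : W a < W (a + 1)
        · omega
        · simp [hlt] at h2
    have h1 := this (s + 1) le_rfl
    have h2 := hW (s + 1) le_rfl
    omega
  · have : ∀ a ≤ s + 1, W a + a ≤ W 0 := by
      intro a
      induction a with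
      | zero => intro _; omega
      | succ a ih =>
        intro ha
        have h1 := ih (by omega)
        obtain ⟨h3, h2⟩ := hstep a (by omega)
        by_cases hlt : W a < W (a + 1)
        · simp [hlt] at h2
        · omega
    have h1 := this (s + 1) le_rfl
    have h2 := hW 0 (by omega)
    omega

theorem ramsey_ge_s5 (r s : ℕ) (hr : 6 ≤ r) (hs : 20 ≤ s) :
    ntower (r - 6) 10 ≤ ramsey r (r + s) 2 := by
  obtain ⟨q, rfl⟩ := Nat.exists_eq_add_of_le hr
  have h0 := shiftCol_iter (q + 4) 1 (lbd (q + 4)) (shiftCol_one _)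
  rw [show 1 + (q + 4) = q + 5 by ring] at h0
  obtain ⟨φ, hφ⟩ := no_clique_s5 (q + 5) _ s hs h0
  rw [show q + 5 + 1 = 6 + q by ring] at hφ
  have hne : {n | ∀ φ : Finset ℕ → Fin 2, HasMonoClique n (6 + q) (6 + q + s) 2 φ}.Nonempty := by
    refine ⟨ubd (6 + q + s) (5 + q), ?_⟩
    intro ψ
    have := rprop_ubd (6 + q + s) (by omega) (5 + q)
    rw [show 5 + q + 1 = 6 + q by ring] at this
    exact this (Finset.range _) (by simp) ψ
  have hmem := Nat.sInf_mem hne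
  have h1 : lbd (q + 4) < ramsey (6 + q) (6 + q + s) 2 := by
    by_contra! hle
    exact hφ _ hle (hmem φ)
  have h2 := lbd_ge (q + 4)
  have h3 := ntower_mono_left q 4 10
  rw [show 6 + q - 6 = q by omega]
  omega

/-! ### Comparison -/

theorem ntower_strictMono (i x y : ℕ) (h : x < y) : ntower i x < ntower i y := by
  induction i with
  | zero => exact h
  | succ i ih => exact Nat.pow_lt_pow_right (by norm_num) ih

theorem ntower_add (i j x : ℕ) : ntower (i + j) x = ntower i (ntower j x) := by
  induction i with
  | zero => rw [Nat.zero_add]; rfl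
  | succ i ih => rw [Nat.succ_add]; simp only [ntower, ih]

theorem two_pow_le_ntower (j : ℕ) : 2 ^ j ≤ ntower j 10 := by
  cases j with
  | zero => simp [ntower]
  | succ j =>
    have := ntower_ge j 10
    exact Nat.pow_le_pow_right (by norm_num) (by omega)

theorem sq_le_two_pow (n : ℕ) (hn : 4 ≤ n) : n ^ 2 ≤ 2 ^ n := by
  induction n, hn using Nat.le_induction with
  | base => norm_num
  | succ n hn ih => rw [pow_succ 2 n]; nlinarith

theorem middle (r s E : ℕ) (hE : 1 ≤ E) (hs : 1 ≤ s) (hd : s + 121 * E + 6 ≤ r)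
    (hr : r ≤ E * (r - s)) :
    ntower (s - 1) (10 * (r + s)) < ntower (r - 6) 10 := by
  obtain ⟨j, rfl⟩ : ∃ j, r = s + j + 5 := ⟨r - s - 5, by omega⟩
  rw [show s + j + 5 - 6 = (s - 1) + j by omega, ntower_add]
  apply ntower_strictMono
  refine lt_of_lt_of_le ?_ (two_pow_le_ntower j)
  refine lt_of_lt_of_le ?_ (sq_le_two_pow j (by omega))
  rw [show s + j + 5 - s = j + 5 by omega] at hr
  have h1 : 121 * E + 1 ≤ j := by omega
  have h2 : E * (j + 5) ≤ E * (6 * j) := Nat.mul_le_mul_left _ (by omega)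
  nlinarith

/-- There is a constant `c > 0` such that for every `ε > 0` there is `r₀`
with: for all `r ≥ r₀` and integers `s` with `εr ≤ s ≤ (1-ε)r`,
`D_r(r+s) ≤ t_{s-1}(c(r+s)) < t_{r-6}(10) ≤ R_r(r+s)`. -/
theorem daisyRamsey_vs_ramsey_technical :
    ∃ c : ℝ, 0 < c ∧ ∀ ε : ℝ, 0 < ε → ∃ r₀ : ℕ, ∀ r : ℕ, r₀ ≤ r → ∀ s : ℕ,
      ε * (r : ℝ) ≤ (s : ℝ) → (s : ℝ) ≤ (1 - ε) * (r : ℝ) →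
      (daisyRamsey r (r + s) 2 : ℝ) ≤ rtower (s - 1) (c * ((r : ℝ) + (s : ℝ))) ∧
      rtower (s - 1) (c * ((r : ℝ) + (s : ℝ))) < rtower (r - 6) 10 ∧
      rtower (r - 6) 10 ≤ (ramsey r (r + s) 2 : ℝ) := by
  refine ⟨10, by norm_num, ?_⟩
  intro ε hε
  obtain ⟨E, hE⟩ := exists_nat_ge (1 / ε)
  have hEε : 1 ≤ ε * (E : ℝ) := by
    rw [div_le_iff₀ hε] at hE
    linarith
  have hE1 : 1 ≤ E := by
    rcases Nat.eq_zero_or_pos E with h | h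
    · rw [h] at hEε; norm_num at hEε
    · exact h
  refine ⟨E * (121 * E + 6), ?_⟩
  intro r hr s hs1 hs2
  have hrR : (E : ℝ) * (121 * E + 6) ≤ r := by exact_mod_cast hr
  have hεr : (121 * (E : ℝ) + 6) ≤ ε * r := by
    have h1 : ε * ((E : ℝ) * (121 * E + 6)) ≤ ε * r := mul_le_mul_of_nonneg_left hrR hε.le
    have h2 : 1 * (121 * (E : ℝ) + 6) ≤ (ε * E) * (121 * E + 6) :=
      mul_le_mul_of_nonneg_right hEε (by positivity)
    linarith
  have hsN : 121 * E + 6 ≤ s := by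
    have : (121 * (E : ℝ) + 6) ≤ s := hεr.trans hs1
    exact_mod_cast this
  have hdN : s + 121 * E + 6 ≤ r := by
    have : (s : ℝ) + 121 * (E : ℝ) + 6 ≤ r := by linarith
    exact_mod_cast this
  have hrE : r ≤ E * (r - s) := by
    have h0 : (r : ℝ) ≤ (E : ℝ) * ((r : ℝ) - s) := by
      have h1 : (E : ℝ) * (ε * r) ≤ (E : ℝ) * ((r : ℝ) - s) :=
        mul_le_mul_of_nonneg_left (by linarith) (by positivity)
      have h2 : 1 * (r : ℝ) ≤ (ε * E) * r := mul_le_mul_of_nonneg_right hEε (by positivity)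
      linarith
    rw [← Nat.cast_sub (by omega : s ≤ r)] at h0
    exact_mod_cast h0
  have e1 : (10 : ℝ) * ((r : ℝ) + (s : ℝ)) = ((10 * (r + s) : ℕ) : ℝ) := by push_cast; ring
  have e2 : rtower (r - 6) 10 = (ntower (r - 6) 10 : ℝ) := by
    have := rtower_cast (r - 6) 10
    exact_mod_cast this
  rw [e1, rtower_cast, e2]
  refine ⟨?_, ?_, ?_⟩
  · have h1 := rprop_ubd (r + s) (by omega) (s - 1)
    rw [show s - 1 + 1 = s by omega] at h1
    exact_mod_cast (daisy_le _ r s h1).trans (ubd_le (r + s) (by omega) (s - 1) (by omega))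
  · exact_mod_cast middle r s E hE1 (by omega) hdN hrE
  · exact_mod_cast ramsey_ge_s5 r s (by omega) (by omega)
end

section
/- Let ℓ ≥ 2 and t ≥ 3 be integers, let V be a set, and let A ⊆ V × V be a set of arcs of a directed graph on V. Suppose there is a proper coloring of V with (t−1)^{⌊ℓ/2⌋} colors, i.e., a map c : V → Fin((t−1)^{⌊ℓ/2⌋}) such that c(x) ≠ c(y) whenever (x,y) ∈ A. Then there exists a coloring ψ : A → Fin(ℓ) of the arcs such that there is no monochromatic directed path with t vertices: no sequence x_1, x_2, …, x_t of distinct vertices with (x_i, x_{i+1}) ∈ A for all 1 ≤ i ≤ t−1 and ψ constant on the arcs (x_i, x_{i+1}). -/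
/-- If a digraph `(V, A)` has a proper vertex coloring with
`(t-1)^⌊ℓ/2⌋` colors, then its arcs can be `ℓ`-colored with no monochromatic
directed path on `t` vertices. -/
theorem arc_coloring_no_mono_path {V : Type*} (ℓ t : ℕ) (hℓ : 2 ≤ ℓ) (ht : 3 ≤ t)
    (A : Set (V × V)) (c : V → Fin ((t - 1) ^ (ℓ / 2)))
    (hc : ∀ p ∈ A, c p.1 ≠ c p.2) :
    ∃ ψ : V × V → Fin ℓ,
      ¬ ∃ (x : ℕ → V) (col : Fin ℓ),
        (∀ i < t, ∀ j < t, i ≠ j → x i ≠ x j) ∧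
        (∀ i, i + 1 < t → (x i, x (i + 1)) ∈ A) ∧
        (∀ i, i + 1 < t → ψ (x i, x (i + 1)) = col) := by
  obtain ⟨d, hd⟩ : ∃ d : V → Fin (ℓ / 2) → Fin (t - 1),
      ∀ p ∈ A, d p.1 ≠ d p.2 :=
    ⟨fun v => finFunctionFinEquiv.symm (c v), fun p hp h =>
      hc p hp (finFunctionFinEquiv.symm.injective h)⟩
  have key : ∀ p : V × V, ∃ col : Fin ℓ, p ∈ A → ∃ k : Fin (ℓ / 2),
      (col.val = 2 * k.val ∧ (d p.1 k).val < (d p.2 k).val) ∨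
      (col.val = 2 * k.val + 1 ∧ (d p.2 k).val < (d p.1 k).val) := by
    intro p
    by_cases hp : p ∈ A
    · obtain ⟨k, hk⟩ := Function.ne_iff.mp (hd p hp)
      have hk' : (d p.1 k).val ≠ (d p.2 k).val := fun h => hk (Fin.ext h)
      have hkl := k.isLt
      rcases lt_or_gt_of_ne hk' with h | h
      · exact ⟨⟨2 * k.val, by omega⟩, fun _ => ⟨k, Or.inl ⟨rfl, h⟩⟩⟩
      · exact ⟨⟨2 * k.val + 1, by omega⟩, fun _ => ⟨k, Or.inr ⟨rfl, h⟩⟩⟩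
    · exact ⟨⟨0, by omega⟩, fun h => absurd h hp⟩
  choose ψ hψ using key
  refine ⟨ψ, ?_⟩
  rintro ⟨x, col, -, hA, hcol⟩
  obtain ⟨k, hk⟩ := hψ _ (hA 0 (by omega))
  rw [hcol 0 (by omega)] at hk
  rcases hk with ⟨hk, -⟩ | ⟨hk, -⟩
  · have step : ∀ i, i < t → i ≤ (d (x i) k).val := by
      intro i
      induction i with
      | zero => intro _; omega
      | succ i ih =>
        intro hi
        have h1 := ih (by omega)
        obtain ⟨j, hj⟩ := hψ _ (hA i hi)
        rw [hcol i hi] at hj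
        rcases hj with ⟨e, h⟩ | ⟨e, h⟩
        · have : j = k := Fin.ext (by omega)
          subst this
          simp only at h
          omega
        · omega
    have h1 := step (t - 1) (by omega)
    have h2 := (d (x (t - 1)) k).isLt
    omega
  · have step : ∀ i, i < t → (d (x i) k).val + i < t - 1 := by
      intro i
      induction i with
      | zero => intro _; exact (d (x 0) k).isLt
      | succ i ih =>
        intro hi
        have h1 := ih (by omega)
        obtain ⟨j, hj⟩ := hψ _ (hA i hi)
        rw [hcol i hi] at hj
        rcases hj with ⟨e, h⟩ | ⟨e, h⟩
        · omega
        · have : j = k := Fin.ext (by omega)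
          subst this
          simp only at h
          omega
    have h1 := step (t - 1) (by omega)
    omega
end

section
/- For all real numbers z ≥ 2 and 0 < μ < 1/2 and every integer j ≥ 1, the inequality (1−μ)·t_j(z) ≥ t_j(z − 3^j·μ / 2^{(j−1)·z}) holds. -/
lemma rtower_mono_aux (j : ℕ) {x y : ℝ} (h : x ≤ y) : rtower j x ≤ rtower j y := by
  induction j with
  | zero => simpa [rtower] using h
  | succ j ih => exact Real.rpow_le_rpow_of_exponent_le (by norm_num) ih

lemma two_rpow_ge_aux (y : ℝ) (hy : 2 ≤ y) : y ≤ (2 : ℝ) ^ y := by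
  have h := one_add_mul_self_le_rpow_one_add (s := 1) (by norm_num) (p := y) (by linarith)
  norm_num at h
  linarith

lemma rtower_ge_aux (z : ℝ) (hz : 2 ≤ z) (j : ℕ) : (2 : ℝ) ^ z ≤ rtower (j + 1) z := by
  induction j with
  | zero => simp [rtower]
  | succ j ih =>
    have h2 := two_rpow_ge_aux z hz
    have := two_rpow_ge_aux (rtower (j + 1) z) (by linarith)
    exact ih.trans this

lemma rpow_bound_aux (μ : ℝ) (h0 : 0 < μ) (h1 : μ < 1 / 2) : (2 : ℝ) ^ (-(2 * μ)) ≤ 1 - μ := by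
  have h := rpow_one_add_le_one_add_mul_self (s := -(1 / 2)) (by norm_num) (p := 2 * μ)
    (by linarith) (by linarith)
  have e : (2 : ℝ) ^ (-(2 * μ)) = (1 + -(1 / 2)) ^ (2 * μ) := by
    rw [Real.rpow_neg (by norm_num), ← Real.inv_rpow (by norm_num)]
    norm_num
  rw [e]
  linarith

lemma rtower_step_aux (μ a b : ℝ) (h0 : 0 < μ) (h1 : μ < 1 / 2) (h : a ≤ b - 2 * μ) :
    (2 : ℝ) ^ a ≤ (1 - μ) * (2 : ℝ) ^ b := by
  calc (2 : ℝ) ^ a ≤ (2 : ℝ) ^ (-(2 * μ) + b) :=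
        Real.rpow_le_rpow_of_exponent_le (by norm_num) (by linarith)
    _ = (2 : ℝ) ^ (-(2 * μ)) * (2 : ℝ) ^ b := Real.rpow_add (by norm_num) _ _
    _ ≤ _ := mul_le_mul_of_nonneg_right (rpow_bound_aux μ h0 h1) (by positivity)

/-- For reals `z ≥ 2`, `0 < μ < 1/2` and integers `j ≥ 1`,
`(1-μ) · t_j(z) ≥ t_j(z - 3^j·μ / 2^((j-1)·z))`. -/
theorem tower_shrink (z μ : ℝ) (hz : 2 ≤ z) (hμ0 : 0 < μ) (hμ : μ < 1 / 2)
    (j : ℕ) (hj : 1 ≤ j) :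
    rtower j (z - (3 : ℝ) ^ j * μ / (2 : ℝ) ^ (((j : ℝ) - 1) * z)) ≤ (1 - μ) * rtower j z := by
  induction j, hj using Nat.le_induction generalizing μ with
  | base =>
    simp only [rtower]
    apply rtower_step_aux μ _ _ hμ0 hμ
    norm_num
    linarith
  | succ j hj ih =>
    obtain ⟨k, rfl⟩ : ∃ k, j = k + 1 := ⟨j - 1, by omega⟩
    have hT := rtower_ge_aux z hz k
    have h4 : (4 : ℝ) ≤ (2 : ℝ) ^ z := by
      have := Real.rpow_le_rpow_of_exponent_le (x := 2) (by norm_num) hz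
      norm_num at this
      exact this
    set T := rtower (k + 1) z with hTdef
    have hTpos : 0 < T := by linarith
    have hm : 2 * μ / T < 1 / 2 := by
      rw [div_lt_iff₀ hTpos]
      linarith
    have key := ih (2 * μ / T) (by positivity) hm
    have e : (1 - 2 * μ / T) * T = T - 2 * μ := by
      field_simp
    rw [e] at key
    change (2 : ℝ) ^ rtower (k + 1) _ ≤ (1 - μ) * (2 : ℝ) ^ T
    apply rtower_step_aux μ _ _ hμ0 hμ
    refine (rtower_mono_aux (k + 1) ?_).trans key
    apply sub_le_sub_left
    have e2 : (2 : ℝ) ^ ((((k + 1 + 1 : ℕ) : ℝ) - 1) * z)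
        = (2 : ℝ) ^ ((((k + 1 : ℕ) : ℝ) - 1) * z) * (2 : ℝ) ^ z := by
      rw [← Real.rpow_add (by norm_num)]
      congr 1
      push_cast
      ring
    rw [e2]
    have hP : 0 < (2 : ℝ) ^ ((((k + 1 : ℕ) : ℝ) - 1) * z) := by positivity
    have e3 : (3 : ℝ) ^ (k + 1 + 1) * μ / ((2 : ℝ) ^ ((((k + 1 : ℕ) : ℝ) - 1) * z) * (2 : ℝ) ^ z)
        = (3 : ℝ) ^ (k + 1) * (3 * μ / (2 : ℝ) ^ z) / (2 : ℝ) ^ ((((k + 1 : ℕ) : ℝ) - 1) * z) := by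
      rw [pow_succ]
      field_simp
    rw [e3]
    have : 2 * μ / T ≤ 3 * μ / (2 : ℝ) ^ z :=
      div_le_div₀ (by linarith) (by linarith) (by linarith) hT
    gcongr
end

section
/- For every integer x ≥ 20 and every integer j ≥ 1, bt_j(x) ≥ t_j(x − Σ_{i=1}^{j} x/3^i) ≥ t_j(x/2), where bt_j(x) is regarded as a real number. -/
/-- The binomial tower function: `bt_0(x) = x`, `bt_{i+1}(x) = C(bt_i(x), ⌊bt_i(x)/2⌋)`. -/
def bt : ℕ → ℕ → ℕ
  | 0, x => x
  | i + 1, x => Nat.choose (bt i x) (bt i x / 2)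

theorem cube_le (n : ℕ) (hn : 20 ≤ n) : (n + 1) ^ 3 ≤ 2 ^ n := by
  induction n, hn using Nat.le_induction with
  | base => norm_num
  | succ n hn ih =>
    rw [pow_succ 2 n]
    nlinarith [Nat.mul_le_mul hn hn, Nat.mul_le_mul (Nat.mul_le_mul hn (le_refl n)) (le_refl n)]

theorem two_pow_le_mid (n : ℕ) : 2 ^ n ≤ (n + 1) * n.choose (n / 2) := by
  rw [← Nat.sum_range_choose]
  calc ∑ m ∈ Finset.range (n + 1), n.choose m
      ≤ ∑ _m ∈ Finset.range (n + 1), n.choose (n / 2) :=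
        Finset.sum_le_sum fun m _ => Nat.choose_le_middle m n
    _ = _ := by simp

theorem mid_ge (n : ℕ) (hn : 20 ≤ n) (s : ℝ) (hs : s ≤ 2 * n / 3) :
    (2 : ℝ) ^ s ≤ (n.choose (n / 2) : ℝ) := by
  have h1 : (2 : ℝ) ^ n ≤ (n + 1) * (n.choose (n / 2) : ℝ) := by
    exact_mod_cast two_pow_le_mid n
  have h2 : ((n : ℝ) + 1) ≤ (2 : ℝ) ^ ((n : ℝ) / 3) := by
    have h3 : ((n : ℝ) + 1) ^ 3 ≤ 2 ^ n := by exact_mod_cast cube_le n hn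
    have h4 : ((2 : ℝ) ^ ((n : ℝ) / 3)) ^ 3 = 2 ^ n := by
      rw [← Real.rpow_natCast, ← Real.rpow_mul (by norm_num), ← Real.rpow_natCast]
      congr 1
      push_cast
      ring
    rw [← h4] at h3
    exact le_of_pow_le_pow_left₀ (by norm_num) (by positivity) h3
  have h5 : (2 : ℝ) ^ s ≤ 2 ^ (2 * (n : ℝ) / 3) :=
    Real.rpow_le_rpow_of_exponent_le (by norm_num) hs
  refine h5.trans ?_
  have h6 : (2 : ℝ) ^ (2 * (n : ℝ) / 3) * (2 : ℝ) ^ ((n : ℝ) / 3) = 2 ^ n := by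
    rw [← Real.rpow_add (by norm_num), ← Real.rpow_natCast]
    congr 1
    ring
  have h7 : (0 : ℝ) < (2 : ℝ) ^ ((n : ℝ) / 3) := by positivity
  refine le_of_mul_le_mul_right ?_ h7
  rw [h6]
  refine h1.trans ?_
  rw [mul_comm]
  gcongr

theorem rtower_mono (j : ℕ) : Monotone (rtower j) := by
  induction j with
  | zero => exact fun a b h => h
  | succ j ih =>
    exact fun a b h => Real.rpow_le_rpow_of_exponent_le (by norm_num) (ih h)

theorem two_rpow_ge (a : ℝ) (h : 10 ≤ a) : (1024 : ℝ) ≤ 2 ^ a := by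
  calc (1024 : ℝ) = 2 ^ (10 : ℝ) := by norm_num
    _ ≤ _ := Real.rpow_le_rpow_of_exponent_le (by norm_num) h

theorem rtower_ge (j : ℕ) (y : ℝ) (h : 10 ≤ y) : 10 ≤ rtower j y := by
  induction j with
  | zero => exact h
  | succ j ih =>
    have := two_rpow_ge _ ih
    change (10 : ℝ) ≤ 2 ^ rtower j y
    linarith

theorem gap_step (a b c : ℝ) (ha : 10 ≤ a) (hc : 0 ≤ c) (hc1 : c ≤ 1) (h : b + c ≤ a) :
    (2 : ℝ) ^ b + 3 * c ≤ 2 ^ a := by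
  have h1 : (2 : ℝ) ^ b ≤ 2 ^ (a + -c) :=
    Real.rpow_le_rpow_of_exponent_le (by norm_num) (by linarith)
  rw [Real.rpow_add (by norm_num)] at h1
  have h2 : (2 : ℝ) ^ (-c) ≤ 1 - c / 2 := by
    have := rpow_one_add_le_one_add_mul_self (s := (-1 / 2 : ℝ)) (by norm_num) hc hc1
    have e : (2 : ℝ) ^ (-c) = (1 + (-1 / 2)) ^ c := by
      rw [Real.rpow_neg (by norm_num), ← Real.inv_rpow (by norm_num)]
      norm_num
    rw [e]
    linarith
  have h3 := two_rpow_ge a ha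
  nlinarith [mul_le_mul_of_nonneg_left h2 (by linarith : (0 : ℝ) ≤ 2 ^ a)]

theorem gap (m : ℕ) (y z : ℝ) (hy : 10 ≤ y) (h : z + 1 / 3 ^ m ≤ y) (k : ℕ) (hk : k ≤ m) :
    rtower k z + 3 ^ k / 3 ^ m ≤ rtower k y := by
  induction k with
  | zero => simpa [rtower] using h
  | succ k ih =>
    have h1 := gap_step _ _ _ (rtower_ge k y hy) (by positivity)
      ((div_le_one (by positivity)).2 (pow_le_pow_right₀ (by norm_num) (by omega)))
      (ih (by omega))
    have e : (3 : ℝ) ^ (k + 1) / 3 ^ m = 3 * (3 ^ k / 3 ^ m) := by ring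
    rw [e]
    exact h1

theorem sum_eq (x : ℝ) (j : ℕ) :
    x - ∑ i ∈ Finset.Icc 1 j, x / 3 ^ i = x / 2 + x / 2 / 3 ^ j := by
  induction j with
  | zero => simp
  | succ j ih =>
    rw [Finset.sum_Icc_succ_top (by omega), ← sub_sub, ih]
    field_simp
    ring

/-- For integers `x ≥ 20` and `j ≥ 1`,
`bt_j(x) ≥ t_j(x - Σ_{i=1}^j x/3^i) ≥ t_j(x/2)`. -/
theorem binomialTower_ge_tower (x j : ℕ) (hx : 20 ≤ x) (hj : 1 ≤ j) :
    rtower j ((x : ℝ) - ∑ i ∈ Finset.Icc 1 j, (x : ℝ) / 3 ^ i) ≤ (bt j x : ℝ) ∧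
    rtower j ((x : ℝ) / 2) ≤ rtower j ((x : ℝ) - ∑ i ∈ Finset.Icc 1 j, (x : ℝ) / 3 ^ i) := by
  simp only [sum_eq]
  have hx' : (20 : ℝ) ≤ x := by exact_mod_cast hx
  refine ⟨?_, rtower_mono j (by have : (0 : ℝ) ≤ (x : ℝ) / 2 / 3 ^ j := by positivity
                                linarith)⟩
  induction j, hj using Nat.le_induction with
  | base =>
    exact mid_ge x hx _ (by simp only [rtower]; linarith)
  | succ j hj ih =>
    obtain ⟨m, rfl⟩ : ∃ m, j = m + 1 := ⟨j - 1, by omega⟩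
    have hy : (10 : ℝ) ≤ x / 2 + x / 2 / 3 ^ (m + 1) := by
      have : (0 : ℝ) ≤ (x : ℝ) / 2 / 3 ^ (m + 1) := by positivity
      linarith
    have hg : ((x : ℝ) / 2 + x / 2 / 3 ^ (m + 1 + 1)) + 1 / 3 ^ m
        ≤ x / 2 + x / 2 / 3 ^ (m + 1) := by
      have hp : (0 : ℝ) < 1 / 3 ^ m := by positivity
      have e1 : (x : ℝ) / 2 / 3 ^ (m + 1 + 1) = x / 18 * (1 / 3 ^ m) := by
        field_simp; ring
      have e2 : (x : ℝ) / 2 / 3 ^ (m + 1) = x / 6 * (1 / 3 ^ m) := by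
        field_simp; ring
      rw [e1, e2]
      nlinarith
    have h1 := gap m _ _ hy hg m le_rfl
    rw [div_self (by positivity)] at h1
    have h2 := Real.rpow_le_rpow_of_exponent_le (x := 2) (by norm_num) h1
    rw [Real.rpow_add (by norm_num), Real.rpow_one] at h2
    have h3 := two_rpow_ge _ (rtower_ge m _ hy)
    have h4 := h2.trans ih
    have h5 : (20 : ℝ) ≤ (bt (m + 1) x : ℝ) := by
      have := h3.trans ih
      linarith
    refine mid_ge (bt (m + 1) x) (by exact_mod_cast h5) _ ?_
    change (2 : ℝ) ^ rtower m _ ≤ _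
    linarith
end

section
/- For all integers ℓ ≥ 2, r ≥ 2 and m > r, D_{≤r}(m;ℓ) ≤ R_r(m+r−1; ℓ^r). -/
/-- The coloring `φ` of subsets of `[n]` admits a level-homogeneous `(r,m)`-superdaisy:
disjoint sets `K, M ⊆ [n]` with `|M| = m` such that for each `1 ≤ i ≤ r`, `φ` is
constant on `{K ∪ P : P ⊆ M, |P| = i}`. -/
def HasLevelHomSuperdaisy (n r m ℓ : ℕ) (φ : Finset ℕ → Fin ℓ) : Prop :=
  ∃ K M : Finset ℕ, K ⊆ Finset.range n ∧ M ⊆ Finset.range n ∧ Disjoint K M ∧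
    M.card = m ∧ ∀ i : ℕ, 1 ≤ i → i ≤ r →
      ∃ c : Fin ℓ, ∀ P ⊆ M, P.card = i → φ (K ∪ P) = c

/-- `D_{≤r}(m;ℓ)`: the least `n` such that every `ℓ`-coloring of the subsets of `[n]`
admits a level-homogeneous `(r,m)`-superdaisy. -/
noncomputable def superdaisyRamsey (r m ℓ : ℕ) : ℕ :=
  sInf {n | ∀ φ : Finset ℕ → Fin ℓ, HasLevelHomSuperdaisy n r m ℓ φ}

theorem ramsey_exists (ℓ : ℕ) (r : ℕ) : ∀ m : ℕ, ∃ N : ℕ, ∀ S : Finset ℕ, N ≤ S.card →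
    ∀ φ : Finset ℕ → Fin ℓ, ∃ Y ⊆ S, Y.card = m ∧ ∃ c, ∀ P ⊆ Y, P.card = r → φ P = c := by
  induction r with
  | zero =>
    intro m
    refine ⟨m, fun S hS φ => ?_⟩
    obtain ⟨Y, hY, hc⟩ := Finset.exists_subset_card_eq hS
    refine ⟨Y, hY, hc, φ ∅, fun P _ hP => ?_⟩
    rw [Finset.card_eq_zero.mp hP]
  | succ r ih =>
    have key : ∀ k : ℕ, ∃ N : ℕ, ∀ S : Finset ℕ, N ≤ S.card → ∀ φ : Finset ℕ → Fin ℓ,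
        ∃ Y ⊆ S, Y.card = k ∧ ∃ c : ℕ → Fin ℓ, ∀ a ∈ Y, ∀ Q ⊆ Y, (∀ b ∈ Q, a < b) →
          Q.card = r → φ (insert a Q) = c a := by
      intro k
      induction k with
      | zero =>
        refine ⟨0, fun S _ φ => ⟨∅, by simp, by simp, fun _ => φ ∅, by simp⟩⟩
      | succ k ihk =>
        obtain ⟨N, hN⟩ := ihk
        obtain ⟨N', hN'⟩ := ih N
        refine ⟨N' + 1, fun S hS φ => ?_⟩
        have hne : S.Nonempty := by
          rw [← Finset.card_pos]; omega
        set x := S.min' hne with hx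
        have hxS : x ∈ S := Finset.min'_mem _ _
        obtain ⟨Y', hY', hc', d, hd⟩ := hN' (S.erase x)
          (by rw [Finset.card_erase_of_mem hxS]; omega) (fun Q => φ (insert x Q))
        obtain ⟨Y, hY, hc, c, hcc⟩ := hN Y' hc'.ge φ
        have hlt : ∀ y ∈ Y, x < y := by
          intro y hy
          have h1 := hY' (hY hy)
          rw [Finset.mem_erase] at h1
          exact lt_of_le_of_ne (Finset.min'_le _ _ h1.2) (Ne.symm h1.1)
        have hxY : x ∉ Y := fun h => lt_irrefl _ (hlt x h)
        refine ⟨insert x Y, ?_, by rw [Finset.card_insert_of_notMem hxY, hc],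
          fun a => if a = x then d else c a, ?_⟩
        · intro y hy
          rcases Finset.mem_insert.mp hy with rfl | hy
          · exact hxS
          · exact Finset.mem_of_mem_erase (hY' (hY hy))
        · intro a ha Q hQ hab hQc
          have hQY : Q ⊆ Y := by
            intro b hb
            rcases Finset.mem_insert.mp (hQ hb) with h | h
            · exfalso
              have h1 := hab b hb
              rcases Finset.mem_insert.mp ha with h2 | h2
              · omega
              · have := hlt a h2
                omega
            · exact h
          by_cases hax : a = x
          · simp only [hax, if_true]
            exact hd Q (hQY.trans hY) hQc
          · simp only [hax, if_false]
            exact hcc a ((Finset.mem_insert.mp ha).resolve_left hax) Q hQY hab hQc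
    intro m
    obtain ⟨N, hN⟩ := key (ℓ * m)
    refine ⟨N, fun S hS φ => ?_⟩
    obtain ⟨Y, hY, hc, c, hcc⟩ := hN S hS φ
    have hp : ∃ y ∈ (Finset.univ : Finset (Fin ℓ)), m ≤ (Y.filter (fun a => c a = y)).card := by
      apply Finset.exists_le_card_fiber_of_mul_le_card_of_maps_to
      · intro a _; exact Finset.mem_univ _
      · exact ⟨φ ∅, Finset.mem_univ _⟩
      · simp [hc]
    obtain ⟨y, _, hy⟩ := hp
    obtain ⟨Z, hZ, hZc⟩ := Finset.exists_subset_card_eq hy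
    refine ⟨Z, (hZ.trans (Finset.filter_subset _ _)).trans hY, hZc, y, fun P hP hPc => ?_⟩
    have hne : P.Nonempty := by
      rw [← Finset.card_pos]; omega
    have ha := Finset.min'_mem P hne
    have haY := Finset.mem_filter.mp (hZ (hP ha))
    have h := hcc (P.min' hne) haY.1 (P.erase (P.min' hne))
      (fun b hb => (Finset.mem_filter.mp (hZ (hP (Finset.mem_of_mem_erase hb)))).1)
      (fun b hb => Finset.min'_lt_of_mem_erase_min' P hne hb)
      (by rw [Finset.card_erase_of_mem ha]; omega)
    rw [Finset.insert_erase ha] at h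
    rw [h, haY.2]

theorem exists_initial (Y : Finset ℕ) (k : ℕ) (hk : k ≤ Y.card) :
    ∃ M ⊆ Y, M.card = k ∧ ∀ a ∈ M, ∀ b ∈ Y \ M, a < b := by
  induction k with
  | zero => exact ⟨∅, by simp, by simp, by simp⟩
  | succ k ih =>
    obtain ⟨M, hM, hc, h⟩ := ih (by omega)
    have hne : (Y \ M).Nonempty := by
      rw [← Finset.card_pos, Finset.card_sdiff_of_subset hM]; omega
    have hx := Finset.min'_mem _ hne
    have hle : ∀ b ∈ Y \ M, (Y \ M).min' hne ≤ b := fun b hb => Finset.min'_le (Y \ M) b hb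
    generalize (Y \ M).min' hne = x at hx hle
    have hx' := Finset.mem_sdiff.mp hx
    refine ⟨insert x M, Finset.insert_subset hx'.1 hM,
      by rw [Finset.card_insert_of_notMem hx'.2, hc], ?_⟩
    intro a ha b hb
    simp only [Finset.mem_sdiff, Finset.mem_insert, not_or] at hb
    have hb' : b ∈ Y \ M := Finset.mem_sdiff.mpr ⟨hb.1, hb.2.2⟩
    rcases Finset.mem_insert.mp ha with rfl | ha
    · exact lt_of_le_of_ne (hle b hb') (Ne.symm hb.2.1)
    · exact h a ha b hb'

/-- The first `i` elements of `P`. -/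
def firstElems (i : ℕ) (P : Finset ℕ) : Finset ℕ :=
  P.filter (fun x => (P.filter (fun y => y < x)).card < i)

theorem firstElems_union (A B : Finset ℕ) (h : ∀ a ∈ A, ∀ b ∈ B, a < b) :
    firstElems A.card (A ∪ B) = A := by
  ext x
  simp only [firstElems, Finset.mem_filter, Finset.mem_union]
  constructor
  · rintro ⟨hx | hx, hc⟩
    · exact hx
    · exfalso
      have : A ⊆ (A ∪ B).filter (fun y => y < x) := fun a ha =>
        Finset.mem_filter.mpr ⟨Finset.mem_union_left _ ha, h a ha x hx⟩
      have := Finset.card_le_card this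
      omega
  · intro hx
    refine ⟨Or.inl hx, ?_⟩
    have : (A ∪ B).filter (fun y => y < x) ⊆ A.erase x := by
      intro y hy
      obtain ⟨hy, hyx⟩ := Finset.mem_filter.mp hy
      refine Finset.mem_erase.mpr ⟨hyx.ne, ?_⟩
      rcases Finset.mem_union.mp hy with hy | hy
      · exact hy
      · exact absurd (h x hx y hy) (by omega)
    exact (Finset.card_le_card this).trans_lt (Finset.card_erase_lt_of_mem hx)

/-- For all integers `ℓ ≥ 2`, `r ≥ 2` and `m > r`,
`D_{≤r}(m;ℓ) ≤ R_r(m+r-1; ℓ^r)`. -/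
theorem superdaisyRamsey_le (ℓ r m : ℕ) (hℓ : 2 ≤ ℓ) (hr : 2 ≤ r) (hm : r < m) :
    superdaisyRamsey r m ℓ ≤ ramsey r (m + r - 1) (ℓ ^ r) := by
  have hne : {n | ∀ φ : Finset ℕ → Fin (ℓ ^ r),
      HasMonoClique n r (m + r - 1) (ℓ ^ r) φ}.Nonempty := by
    obtain ⟨N, hN⟩ := ramsey_exists (ℓ ^ r) r (m + r - 1)
    exact ⟨N, fun φ => hN (Finset.range N) (by simp) φ⟩
  have hmem := Nat.sInf_mem hne
  apply Nat.sInf_le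
  intro φ
  change ∀ φ : Finset ℕ → Fin (ℓ ^ r),
    HasMonoClique (ramsey r (m + r - 1) (ℓ ^ r)) r (m + r - 1) (ℓ ^ r) φ at hmem
  obtain ⟨Y, hY, hYc, c, hc⟩ :=
    hmem (fun P => finFunctionFinEquiv (fun i : Fin r => φ (firstElems (i.val + 1) P)))
  obtain ⟨M, hM, hMc, hlt⟩ := exists_initial Y m (by omega)
  refine ⟨∅, M, by simp, hM.trans hY, by simp, hMc, fun i hi hir => ?_⟩
  refine ⟨finFunctionFinEquiv.symm c ⟨i - 1, by omega⟩, fun P hP hPc => ?_⟩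
  have hT : r - i ≤ (Y \ M).card := by
    rw [Finset.card_sdiff_of_subset hM]; omega
  obtain ⟨B, hB, hBc⟩ := Finset.exists_subset_card_eq hT
  have hPB : ∀ a ∈ P, ∀ b ∈ B, a < b := fun a ha b hb => hlt a (hP ha) b (hB hb)
  have hdis : Disjoint P B := Finset.disjoint_left.mpr fun a ha hb => lt_irrefl _ (hPB a ha a hb)
  have h := hc (P ∪ B)
    (Finset.union_subset (hP.trans hM) (hB.trans Finset.sdiff_subset))
    (by rw [Finset.card_union_of_disjoint hdis]; omega)
  rw [← h, Equiv.symm_apply_apply]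
  have hi1 : i - 1 + 1 = P.card := by omega
  simp only [hi1, firstElems_union P B hPB, Finset.empty_union]
end

section
/- For all integers k ≥ 2, ℓ ≥ 2, r ≥ 2 and m > r, D_r(m,k;ℓ^r) ≥ R_r(⌈m/(k+1)⌉; ℓ). -/
/-- The coloring `φ` of the `(k+r)`-element subsets of `[n]` admits a monochromatic
`(r,m,k)`-daisy: disjoint sets `K, M ⊆ [n]` with `|K| = k`, `|M| = m` such that `φ`
is constant on `{K ∪ P : P ⊆ M, |P| = r}`. -/
def HasMonoDaisyK (n r m k ℓ : ℕ) (φ : Finset ℕ → Fin ℓ) : Prop :=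
  ∃ K M : Finset ℕ, K ⊆ Finset.range n ∧ M ⊆ Finset.range n ∧ Disjoint K M ∧
    K.card = k ∧ M.card = m ∧ ∃ c : Fin ℓ, ∀ P ⊆ M, P.card = r → φ (K ∪ P) = c

/-- `D_r(m,k;ℓ)`: the least `n` such that every `ℓ`-coloring of the `(k+r)`-element
subsets of `[n]` admits a monochromatic `(r,m,k)`-daisy. -/
noncomputable def daisyRamseyK (r m k ℓ : ℕ) : ℕ :=
  sInf {n | ∀ φ : Finset ℕ → Fin ℓ, HasMonoDaisyK n r m k ℓ φ}

/-- As `HasMonoDaisyK`, additionally requiring the daisy to be *simple*: every element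
of the kernel `K` is either below all of `M` or above all of `M`. -/
def HasMonoSimpleDaisyK (n r m k ℓ : ℕ) (φ : Finset ℕ → Fin ℓ) : Prop :=
  ∃ K M : Finset ℕ, K ⊆ Finset.range n ∧ M ⊆ Finset.range n ∧ Disjoint K M ∧
    K.card = k ∧ M.card = m ∧ (∀ x ∈ K, (∀ y ∈ M, x < y) ∨ (∀ y ∈ M, y < x)) ∧
    ∃ c : Fin ℓ, ∀ P ⊆ M, P.card = r → φ (K ∪ P) = c

/-- `D_r^smp(m,k;ℓ)`: the least `n` such that every `ℓ`-coloring of the `(k+r)`-element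
subsets of `[n]` admits a monochromatic simple `(r,m,k)`-daisy. -/
noncomputable def simpleDaisyRamseyK (r m k ℓ : ℕ) : ℕ :=
  sInf {n | ∀ φ : Finset ℕ → Fin ℓ, HasMonoSimpleDaisyK n r m k ℓ φ}

open Finset in
theorem daisyAux_endHom (ℓ r : ℕ)
    (H : ∀ m : ℕ, ∃ n : ℕ, ∀ X : Finset ℕ, n ≤ X.card → ∀ φ : Finset ℕ → Fin ℓ,
      ∃ Y ⊆ X, Y.card = m ∧ ∃ c, ∀ P ⊆ Y, P.card = r → φ P = c) (t : ℕ) :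
    ∃ n : ℕ, ∀ X : Finset ℕ, n ≤ X.card → ∀ φ : Finset ℕ → Fin ℓ,
      ∃ Y ⊆ X, Y.card = t ∧ ∀ x ∈ Y, ∃ c, ∀ P ⊆ Y, P.card = r → (∀ y ∈ P, x < y) →
        φ (insert x P) = c := by
  induction t with
  | zero => exact ⟨0, fun X _ φ => ⟨∅, by simp, by simp, by simp⟩⟩
  | succ t ih =>
    obtain ⟨n, hn⟩ := ih
    obtain ⟨N, hN⟩ := H n
    refine ⟨N + 1, fun X hX φ => ?_⟩
    have hne : X.Nonempty := by rw [← card_pos]; omega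
    set x := X.min' hne with hx
    have hxX : x ∈ X := X.min'_mem hne
    obtain ⟨Z, hZ, hZc, c, hc⟩ := hN (X.erase x) (by rw [card_erase_of_mem hxX]; omega)
      (fun P => φ (insert x P))
    obtain ⟨Y, hY, hYc, hg⟩ := hn Z hZc.ge φ
    have hlt : ∀ y ∈ Y, x < y := fun y hy => by
      have h1 := hZ (hY hy)
      rw [mem_erase] at h1
      exact lt_of_le_of_ne (X.min'_le y h1.2) (Ne.symm h1.1)
    have hxY : x ∉ Y := fun h => lt_irrefl _ (hlt x h)
    refine ⟨insert x Y, ?_, by rw [card_insert_of_notMem hxY, hYc], ?_⟩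
    · intro y hy
      rcases mem_insert.1 hy with rfl | hy
      · exact hxX
      · exact (mem_erase.1 (hZ (hY hy))).2
    · intro y hy
      have key : ∀ P ⊆ insert x Y, x ∉ P → P ⊆ Y := fun P hP hxP z hz => by
        rcases mem_insert.1 (hP hz) with rfl | h
        · exact absurd hz hxP
        · exact h
      rcases mem_insert.1 hy with hyx | hy
      · subst hyx
        exact ⟨c, fun P hP hPr hlt' =>
          hc P ((key P hP fun h => lt_irrefl _ (hlt' _ h)).trans hY) hPr⟩
      · obtain ⟨d, hd⟩ := hg y hy
        exact ⟨d, fun P hP hPr hlt' =>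
          hd P (key P hP fun h => lt_asymm (hlt' _ h) (hlt y hy)) hPr hlt'⟩

open Finset in
theorem daisyAux_ramsey (ℓ r : ℕ) : ∀ m : ℕ, ∃ n : ℕ, ∀ X : Finset ℕ, n ≤ X.card →
    ∀ φ : Finset ℕ → Fin ℓ, ∃ Y ⊆ X, Y.card = m ∧ ∃ c, ∀ P ⊆ Y, P.card = r → φ P = c := by
  induction r with
  | zero =>
    intro m
    refine ⟨m, fun X hX φ => ?_⟩
    obtain ⟨Y, hY, hYc⟩ := exists_subset_card_eq hX
    exact ⟨Y, hY, hYc, φ ∅, fun P _ hP => by rw [card_eq_zero.1 hP]⟩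
  | succ r ih =>
    intro m
    obtain ⟨n, hn⟩ := daisyAux_endHom ℓ r ih (ℓ * m)
    refine ⟨n, fun X hX φ => ?_⟩
    obtain ⟨Y, hY, hYc, hg⟩ := hn X hX φ
    have c0 : Fin ℓ := φ ∅
    have hg' : ∀ x, ∃ c, x ∈ Y → ∀ P ⊆ Y, P.card = r → (∀ y ∈ P, x < y) →
        φ (insert x P) = c := fun x => by
      by_cases hx : x ∈ Y
      · obtain ⟨c, hc⟩ := hg x hx
        exact ⟨c, fun _ => hc⟩
      · exact ⟨c0, fun h => absurd h hx⟩
    choose g hgg using hg'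
    obtain ⟨c, -, hc⟩ := exists_le_card_fiber_of_mul_le_card_of_maps_to
      (s := Y) (t := (univ : Finset (Fin ℓ))) (f := g) (n := m) (fun _ _ => mem_univ _)
      ⟨c0, mem_univ _⟩ (by simp [hYc])
    obtain ⟨W, hW, hWc⟩ := exists_subset_card_eq hc
    have hWY : W ⊆ Y := hW.trans (filter_subset _ _)
    refine ⟨W, hWY.trans hY, hWc, c, fun P hP hPr => ?_⟩
    have hne : P.Nonempty := by rw [← card_pos]; omega
    have hxP := P.min'_mem hne
    have h2 := hgg (P.min' hne) (hWY (hP hxP)) (P.erase (P.min' hne))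
      (((erase_subset _ _).trans hP).trans hWY) (by rw [card_erase_of_mem hxP]; omega)
      (fun y hy => lt_of_le_of_ne (P.min'_le y (mem_erase.1 hy).2) (Ne.symm (mem_erase.1 hy).1))
    rw [insert_erase hxP] at h2
    rw [h2]
    exact (mem_filter.1 (hW (hP hxP))).2

theorem daisyAux_nonempty (r m k ℓ : ℕ) :
    {n | ∀ φ : Finset ℕ → Fin ℓ, HasMonoDaisyK n r m k ℓ φ}.Nonempty := by
  obtain ⟨n, hn⟩ := daisyAux_ramsey ℓ r m
  refine ⟨k + n, fun φ => ?_⟩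
  obtain ⟨Y, hY, hYc, c, hc⟩ := hn (Finset.Ico k (k + n)) (by simp)
    (fun P => φ (Finset.range k ∪ P))
  refine ⟨Finset.range k, Y, ?_, ?_, ?_, by simp, hYc, c, hc⟩
  · intro x hx
    simp at hx ⊢
    omega
  · intro x hx
    have := hY hx
    simp at this ⊢
    omega
  · rw [Finset.disjoint_left]
    intro x hx hx'
    have := hY hx'
    simp at this hx
    omega

/-- The elements of `X` in positions `a, …, a + r - 1`. -/
def daisyWindow (r : ℕ) (X : Finset ℕ) (a : ℕ) : Finset ℕ :=
  X.filter fun x => a ≤ (X.filter (· < x)).card ∧ (X.filter (· < x)).card < a + r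

open Finset in
theorem daisyAux_window (r a : ℕ) (K P : Finset ℕ) (hd : Disjoint K P) (hP : P.card = r)
    (ha : ∀ y ∈ P, (K.filter (· < y)).card = a) :
    daisyWindow r (K ∪ P) a = P ∧ ∀ b, (b + r ≤ a ∨ a + r ≤ b) →
      daisyWindow r (K ∪ P) b = K.filter fun x =>
        b ≤ (K.filter (· < x)).card + (if (K.filter (· < x)).card < a then 0 else r) ∧
        (K.filter (· < x)).card + (if (K.filter (· < x)).card < a then 0 else r) < b + r := by
  have hrank : ∀ x, ((K ∪ P).filter (· < x)).card
      = (K.filter (· < x)).card + (P.filter (· < x)).card := fun x => by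
    rw [filter_union, card_union_of_disjoint]
    exact disjoint_of_subset_left (filter_subset _ _)
      (disjoint_of_subset_right (filter_subset _ _) hd)
  have hPr : ∀ y ∈ P, (P.filter (· < y)).card < r := fun y hy => by
    rw [← hP]
    apply card_lt_card
    rw [filter_ssubset]
    exact ⟨y, hy, lt_irrefl _⟩
  have hK : ∀ x ∈ K, (P.filter (· < x)).card
      = if (K.filter (· < x)).card < a then 0 else r := fun x hx => by
    have hcmp : ∀ y ∈ P, y < x ↔ ¬ (K.filter (· < x)).card < a := fun y hy => by
      have hne : x ≠ y := fun h => disjoint_left.1 hd hx (h ▸ hy)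
      have hay := ha y hy
      constructor
      · intro h
        have : (K.filter (· < y)).card ≤ (K.filter (· < x)).card :=
          card_le_card fun z hz => by
            simp only [mem_filter] at hz ⊢
            exact ⟨hz.1, hz.2.trans h⟩
        omega
      · intro h
        by_contra h'
        have hxy : x < y := by omega
        have : (K.filter (· < x)).card < (K.filter (· < y)).card := by
          apply card_lt_card
          rw [ssubset_iff_of_subset]
          · exact ⟨x, by simp [hx, hxy], by simp⟩
          · intro z hz
            simp only [mem_filter] at hz ⊢
            exact ⟨hz.1, hz.2.trans hxy⟩
        omega
    split_ifs with h
    · rw [card_eq_zero, filter_eq_empty_iff]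
      intro y hy h'
      exact (hcmp y hy).1 h' h
    · rw [filter_true_of_mem, hP]
      intro y hy
      exact (hcmp y hy).2 h
  constructor
  · ext x
    simp only [daisyWindow, mem_filter, mem_union, hrank]
    constructor
    · rintro ⟨hx | hx, h1, h2⟩
      · exfalso
        rw [hK x hx] at h1 h2
        split_ifs at h1 h2 <;> omega
      · exact hx
    · intro hx
      have := ha x hx
      have := hPr x hx
      exact ⟨Or.inr hx, by omega, by omega⟩
  · intro b hb
    ext x
    simp only [daisyWindow, mem_filter, mem_union, hrank]
    constructor
    · rintro ⟨hx | hx, h1, h2⟩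
      · rw [hK x hx] at h1 h2
        exact ⟨hx, h1, h2⟩
      · exfalso
        have := ha x hx
        have := hPr x hx
        omega
    · rintro ⟨hx, h1, h2⟩
      rw [← hK x hx] at h1 h2
      exact ⟨Or.inl hx, h1, h2⟩

open Finset in
theorem daisyAux_main (k ℓ r m n : ℕ) (hℓ : 2 ≤ ℓ) (hr : 2 ≤ r) (hm : r < m)
    (h : ∀ φ : Finset ℕ → Fin (ℓ ^ r), HasMonoDaisyK n r m k (ℓ ^ r) φ)
    (ψ : Finset ℕ → Fin ℓ) : HasMonoClique n r (m ⌈/⌉ (k + 1)) ℓ ψ := by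
  haveI : NeZero ℓ := ⟨by omega⟩
  obtain ⟨K, M, hKn, hMn, hd, hKc, hMc, c, hc⟩ := h fun X =>
    finFunctionFinEquiv fun j : Fin r =>
      ∑ a ∈ (range (k + 1)).filter (fun a => a % r = (j : ℕ)), ψ (daisyWindow r X a)
  obtain ⟨a, haR, ha⟩ := exists_lt_card_fiber_of_mul_lt_card_of_maps_to
    (s := M) (t := range (k + 1)) (f := fun y => (K.filter (· < y)).card)
    (n := m ⌈/⌉ (k + 1) - 1) (fun y _ => by
      have := card_le_card (filter_subset (· < y) K)
      simp only [mem_coe, mem_range]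
      omega) (by
      rw [card_range, hMc, Nat.ceilDiv_eq_add_pred_div]
      have h1 := Nat.div_mul_le_self (m + (k + 1) - 1) (k + 1)
      have h2 : 1 ≤ (m + (k + 1) - 1) / (k + 1) := by
        rw [Nat.le_div_iff_mul_le (by omega)]; omega
      rw [Nat.mul_sub, mul_comm (k + 1)]
      omega)
  obtain ⟨Y, hY, hYc⟩ := exists_subset_card_eq (Nat.le_of_pred_lt ha)
  have hYM : Y ⊆ M := hY.trans (filter_subset _ _)
  refine ⟨Y, hYM.trans hMn, hYc, ?_⟩
  have hcount : ∀ y ∈ Y, (K.filter (· < y)).card = a := fun y hy => (mem_filter.1 (hY hy)).2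
  refine ⟨finFunctionFinEquiv.symm c ⟨a % r, Nat.mod_lt _ (by omega)⟩ -
    ∑ b ∈ ((range (k + 1)).filter (fun b => b % r = a % r)).erase a,
      ψ (K.filter fun x =>
        b ≤ (K.filter (· < x)).card + (if (K.filter (· < x)).card < a then 0 else r) ∧
        (K.filter (· < x)).card + (if (K.filter (· < x)).card < a then 0 else r) < b + r),
    fun P hP hPr => ?_⟩
  obtain ⟨hw1, hw2⟩ := daisyAux_window r a K P
    (disjoint_of_subset_right (hP.trans hYM) hd) hPr (fun y hy => hcount y (hP hy))
  have e := hc P (hP.trans hYM) hPr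
  rw [← e, Equiv.symm_apply_apply]
  rw [← add_sum_erase _ _ (show a ∈ (range (k + 1)).filter (fun b => b % r = a % r) by
    simpa using haR), hw1]
  rw [sum_congr rfl (fun b hb => ?_), add_sub_cancel_right]
  rw [hw2 b]
  simp only [mem_erase, mem_filter] at hb
  have hbr : b % r = a % r := hb.2.2
  rcases lt_or_gt_of_ne hb.1 with hlt | hlt
  · left
    have := (Nat.modEq_iff_dvd' hlt.le).1 hbr
    have := Nat.le_of_dvd (by omega) this
    omega
  · right
    have := (Nat.modEq_iff_dvd' hlt.le).1 hbr.symm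
    have := Nat.le_of_dvd (by omega) this
    omega

/-- For all integers `k ≥ 2`, `ℓ ≥ 2`, `r ≥ 2` and `m > r`,
`D_r(m,k;ℓ^r) ≥ R_r(⌈m/(k+1)⌉; ℓ)`. -/
theorem daisyRamseyK_ge_ramsey (k ℓ r m : ℕ) (hk : 2 ≤ k) (hℓ : 2 ≤ ℓ)
    (hr : 2 ≤ r) (hm : r < m) :
    ramsey r (m ⌈/⌉ (k + 1)) ℓ ≤ daisyRamseyK r m k (ℓ ^ r) := by
  exact Nat.sInf_le (daisyAux_main k ℓ r m _ hℓ hr hm (Nat.sInf_mem (daisyAux_nonempty r m k (ℓ ^ r))))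
end

section
/- For all integers ℓ ≥ 2 and r > k ≥ 2 and m > r, D_r^smp(m,k;ℓ) ≥ R_{r−k}(m−k; ℓ). -/
/-- Lower initial segment of given size. -/
theorem exists_low (M : Finset ℕ) (b : ℕ) (h : b ≤ M.card) :
    ∃ B ⊆ M, B.card = b ∧ ∀ x ∈ B, ∀ y ∈ M \ B, x < y := by
  induction b with
  | zero => exact ⟨∅, by simp, by simp, by simp⟩
  | succ b ih =>
    obtain ⟨B, hB, hc, hlt⟩ := ih (by omega)
    have hne : (M \ B).Nonempty := by
      rw [← Finset.card_pos, Finset.card_sdiff_of_subset hB]; omega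
    obtain ⟨a, hmem, hmin⟩ : ∃ a ∈ M \ B, ∀ y ∈ M \ B, a ≤ y :=
      ⟨_, Finset.min'_mem _ hne, fun y hy => Finset.min'_le _ y hy⟩
    rw [Finset.mem_sdiff] at hmem
    refine ⟨insert a B, ?_, ?_, ?_⟩
    · exact Finset.insert_subset hmem.1 hB
    · rw [Finset.card_insert_of_notMem hmem.2, hc]
    · intro x hx y hy
      simp only [Finset.mem_sdiff, Finset.mem_insert, not_or] at hx hy
      have hy' : y ∈ M \ B := by simp [hy]
      rcases hx with rfl | hx
      · exact lt_of_le_of_ne (hmin y hy') (Ne.symm hy.2.1)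
      · exact hlt x hx y hy'

/-- Upper final segment of given size. -/
theorem exists_high (M : Finset ℕ) (b : ℕ) (h : b ≤ M.card) :
    ∃ B ⊆ M, B.card = b ∧ ∀ x ∈ B, ∀ y ∈ M \ B, y < x := by
  obtain ⟨C, hC, hc, hlt⟩ := exists_low M (M.card - b) (by omega)
  refine ⟨M \ C, Finset.sdiff_subset, ?_, ?_⟩
  · rw [Finset.card_sdiff_of_subset hC]; omega
  · intro x hx y hy
    refine hlt y ?_ x hx
    simp only [Finset.mem_sdiff] at hy
    tauto

/-- Remove the `k` smallest and the `k` largest elements. -/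
def midPart (k : ℕ) (X : Finset ℕ) : Finset ℕ :=
  X.filter (fun x => k ≤ (X.filter (fun y => y < x)).card ∧ k ≤ (X.filter (fun y => x < y)).card)

theorem midPart_eq (k : ℕ) (L Q U : Finset ℕ) (hL : L.card = k) (hU : U.card = k)
    (hLQ : ∀ x ∈ L, ∀ y ∈ Q, x < y) (hQU : ∀ x ∈ Q, ∀ y ∈ U, x < y)
    (hLU : ∀ x ∈ L, ∀ y ∈ U, x < y) : midPart k (L ∪ Q ∪ U) = Q := by
  ext x
  simp only [midPart, Finset.mem_filter]
  constructor
  · rintro ⟨hx, h1, h2⟩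
    by_contra hxQ
    simp only [Finset.mem_union] at hx
    rcases hx with (hx | hx) | hx
    · have : ((L ∪ Q ∪ U).filter (fun y => y < x)) ⊂ L := by
        rw [Finset.ssubset_iff_of_subset]
        · exact ⟨x, hx, by simp⟩
        · intro y hy
          simp only [Finset.mem_filter, Finset.mem_union] at hy
          rcases hy with ⟨(hy | hy) | hy, h⟩
          · exact hy
          · have := hLQ x hx y hy; omega
          · have := hLU x hx y hy; omega
      have := Finset.card_lt_card this
      omega
    · exact hxQ hx
    · have : ((L ∪ Q ∪ U).filter (fun y => x < y)) ⊂ U := by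
        rw [Finset.ssubset_iff_of_subset]
        · exact ⟨x, hx, by simp⟩
        · intro y hy
          simp only [Finset.mem_filter, Finset.mem_union] at hy
          rcases hy with ⟨(hy | hy) | hy, h⟩
          · have := hLU y hy x hx; omega
          · have := hQU y hy x hx; omega
          · exact hy
      have := Finset.card_lt_card this
      omega
  · intro hx
    refine ⟨by simp [hx], ?_, ?_⟩
    · rw [← hL]
      apply Finset.card_le_card
      intro y hy
      simp [hy, hLQ y hy x hx]
    · rw [← hU]
      apply Finset.card_le_card
      intro y hy
      simp [hy, hQU x hx y hy]

theorem finite_ramsey (ℓ : ℕ) (hℓ : 0 < ℓ) (r : ℕ) : ∀ m : ℕ, ∃ n : ℕ, ∀ S : Finset ℕ, n ≤ S.card →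
    ∀ φ : Finset ℕ → Fin ℓ, ∃ Y ⊆ S, Y.card = m ∧ ∃ c, ∀ P ⊆ Y, P.card = r → φ P = c := by
  induction r with
  | zero =>
    intro m
    refine ⟨m, fun S hS φ => ?_⟩
    obtain ⟨Y, hY, hc⟩ := Finset.exists_subset_card_eq hS
    refine ⟨Y, hY, hc, φ ∅, fun P _ hP => ?_⟩
    rw [Finset.card_eq_zero.1 hP]
  | succ r ih =>
    have key : ∀ t : ℕ, ∃ n : ℕ, ∀ S : Finset ℕ, n ≤ S.card → ∀ φ : Finset ℕ → Fin ℓ,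
        ∃ T ⊆ S, T.card = t ∧ ∃ f : ℕ → Fin ℓ, ∀ x ∈ T, ∀ P ⊆ T, (∀ y ∈ P, x < y) →
          P.card = r → φ (insert x P) = f x := by
      intro t
      induction t with
      | zero =>
        exact ⟨0, fun S _ φ => ⟨∅, by simp, by simp, fun _ => ⟨0, hℓ⟩, by simp⟩⟩
      | succ t iht =>
        obtain ⟨N, hN⟩ := iht
        obtain ⟨n, hn⟩ := ih N
        refine ⟨n + 1, fun S hS φ => ?_⟩
        obtain ⟨B, hB, hBc, hlt⟩ := exists_low S 1 (by omega)
        obtain ⟨a, rfl⟩ := Finset.card_eq_one.1 hBc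
        obtain ⟨Y, hY, hYc, c, hc⟩ := hn (S \ {a})
          (by rw [Finset.card_sdiff_of_subset hB, hBc]; omega) (fun P => φ (insert a P))
        obtain ⟨T, hT, hTc, f, hf⟩ := hN Y hYc.ge φ
        have hgt : ∀ y ∈ T, a < y := fun y hy => hlt a (by simp) y (hY (hT hy))
        have haT : a ∉ T := fun h => lt_irrefl _ (hgt a h)
        refine ⟨insert a T, ?_, ?_, Function.update f a c, ?_⟩
        · exact Finset.insert_subset (hB (by simp))
            ((hT.trans hY).trans Finset.sdiff_subset)
        · rw [Finset.card_insert_of_notMem haT, hTc]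
        · intro x hx P hP hxP hPc
          have hPT : P ⊆ T := by
            intro y hy
            have h1 := hxP y hy
            rcases Finset.mem_insert.1 (hP hy) with rfl | h
            · rcases Finset.mem_insert.1 hx with rfl | h'
              · omega
              · have := hgt x h'; omega
            · exact h
          rcases Finset.mem_insert.1 hx with rfl | h
          · simpa using hc P (hPT.trans hT) hPc
          · rw [Function.update_of_ne (show x ≠ a from fun e => haT (e ▸ h))]
            exact hf x h P hPT hxP hPc
    intro m
    obtain ⟨n, hn⟩ := key (ℓ * m)
    refine ⟨n, fun S hS φ => ?_⟩
    obtain ⟨T, hT, hTc, f, hf⟩ := hn S hS φ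
    obtain ⟨c, -, hcc⟩ := Finset.exists_le_card_fiber_of_mul_le_card_of_maps_to
      (s := T) (t := (Finset.univ : Finset (Fin ℓ))) (f := f) (n := m) (by simp)
      ⟨⟨0, hℓ⟩, by simp⟩ (by simp [hTc])
    obtain ⟨Y, hY, hYc⟩ := Finset.exists_subset_card_eq hcc
    refine ⟨Y, (hY.trans (Finset.filter_subset _ _)).trans hT, hYc, c, fun P hP hPc => ?_⟩
    obtain ⟨B, hB, hBc, hlt⟩ := exists_low P 1 (by omega)
    obtain ⟨a, rfl⟩ := Finset.card_eq_one.1 hBc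
    have haP : a ∈ P := hB (by simp)
    have ha := Finset.mem_filter.1 (hY (hP haP))
    have := hf a ha.1 (P \ {a})
      (Finset.sdiff_subset.trans ((hP.trans hY).trans (Finset.filter_subset _ _)))
      (fun y hy => hlt a (by simp) y hy)
      (by rw [Finset.card_sdiff_of_subset hB, hBc]; omega)
    rw [ha.2] at this
    rw [← this]
    congr 1
    ext z
    by_cases hz : z = a <;> simp [hz, haP]

/-- For all integers `ℓ ≥ 2`, `r > k ≥ 2` and `m > r`,
`D_r^smp(m,k;ℓ) ≥ R_{r-k}(m-k; ℓ)`. -/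
theorem simpleDaisyRamseyK_ge_ramsey (ℓ r k m : ℕ) (hℓ : 2 ≤ ℓ)
    (hk : 2 ≤ k) (hkr : k < r) (hm : r < m) :
    ramsey (r - k) (m - k) ℓ ≤ simpleDaisyRamseyK r m k ℓ := by
  have hne : {n | ∀ φ : Finset ℕ → Fin ℓ, HasMonoSimpleDaisyK n r m k ℓ φ}.Nonempty := by
    obtain ⟨n, hn⟩ := finite_ramsey ℓ (by omega) (k + r) (k + m)
    refine ⟨n, fun φ => ?_⟩
    obtain ⟨Y, hY, hYc, c, hc⟩ := hn (Finset.range n) (by simp) φ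
    obtain ⟨K, hK, hKc, hlt⟩ := exists_low Y k (by omega)
    refine ⟨K, Y \ K, hK.trans hY, Finset.sdiff_subset.trans hY, Finset.disjoint_sdiff, hKc,
      ?_, fun x hx => Or.inl (hlt x hx), c, fun P hP hPc => ?_⟩
    · rw [Finset.card_sdiff_of_subset hK]; omega
    · refine hc _ (Finset.union_subset hK (hP.trans Finset.sdiff_subset)) ?_
      rw [Finset.card_union_of_disjoint (Finset.disjoint_of_subset_right hP Finset.disjoint_sdiff)]
      omega
  have hmem := Nat.sInf_mem hne
  refine Nat.sInf_le ?_
  change ∀ φ, HasMonoClique (simpleDaisyRamseyK r m k ℓ) _ _ _ φ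
  change ∀ φ, HasMonoSimpleDaisyK (simpleDaisyRamseyK r m k ℓ) _ _ _ _ φ at hmem
  generalize simpleDaisyRamseyK r m k ℓ = n at hmem
  intro ψ
  obtain ⟨K, M, hK, hM, hd, hKc, hMc, hs, c, hc⟩ := hmem (fun X => ψ (midPart k X))
  classical
  obtain ⟨y0, hy0⟩ : M.Nonempty := by rw [← Finset.card_pos]; omega
  obtain ⟨K1, hK1⟩ : ∃ K1, K1 = K.filter (fun x => ∀ y ∈ M, x < y) := ⟨_, rfl⟩
  obtain ⟨K2, hK2⟩ : ∃ K2, K2 = K.filter (fun x => ¬ ∀ y ∈ M, x < y) := ⟨_, rfl⟩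
  have hKU : K1 ∪ K2 = K := by rw [hK1, hK2]; exact Finset.filter_union_filter_not_eq _ _
  have hcard : K1.card + K2.card = k := by
    rw [hK1, hK2, ← hKc]; exact Finset.card_filter_add_card_filter_not _
  have h1 : ∀ x ∈ K1, ∀ y ∈ M, x < y := by
    intro x hx; rw [hK1] at hx; exact (Finset.mem_filter.1 hx).2
  have h2 : ∀ x ∈ K2, ∀ y ∈ M, y < x := by
    intro x hx; rw [hK2] at hx
    have := Finset.mem_filter.1 hx
    exact (hs x this.1).resolve_left this.2
  clear hK1 hK2
  obtain ⟨B, hB, hBc, hBlt⟩ := exists_low M K2.card (by omega)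
  have hMB : (M \ B).card = m - K2.card := by rw [Finset.card_sdiff_of_subset hB, hMc, hBc]
  obtain ⟨A, hA, hAc, hAlt⟩ := exists_high (M \ B) K1.card (by omega)
  have hAM : A ⊆ M := hA.trans Finset.sdiff_subset
  have hYM : (M \ B) \ A ⊆ M := Finset.sdiff_subset.trans Finset.sdiff_subset
  refine ⟨(M \ B) \ A, hYM.trans hM, ?_, c, fun Q hQ hQc => ?_⟩
  · rw [Finset.card_sdiff_of_subset hA, hMB, hAc]; omega
  have hQM := hQ.trans hYM
  have dBQ : Disjoint B Q := Finset.disjoint_of_subset_right (hQ.trans Finset.sdiff_subset)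
    Finset.disjoint_sdiff
  have dBA : Disjoint B A := Finset.disjoint_of_subset_right hA Finset.disjoint_sdiff
  have dQA : Disjoint Q A := (Finset.disjoint_of_subset_right hQ Finset.disjoint_sdiff).symm
  have dKM1 : Disjoint K1 M := Finset.disjoint_of_subset_left (hKU ▸ Finset.subset_union_left) hd
  have dKM2 : Disjoint K2 M := Finset.disjoint_of_subset_left (hKU ▸ Finset.subset_union_right) hd
  have := hc (B ∪ Q ∪ A) (Finset.union_subset (Finset.union_subset hB hQM) hAM) (by
    rw [Finset.card_union_of_disjoint (Finset.disjoint_union_left.2 ⟨dBA, dQA⟩),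
      Finset.card_union_of_disjoint dBQ]
    omega)
  have e : K ∪ (B ∪ Q ∪ A) = (K1 ∪ B) ∪ Q ∪ (A ∪ K2) := by
    rw [← hKU]; ext z; simp only [Finset.mem_union]; tauto
  simp only [e] at this
  rw [midPart_eq] at this
  · exact this
  · rw [Finset.card_union_of_disjoint (Finset.disjoint_of_subset_right hB dKM1)]; omega
  · rw [Finset.card_union_of_disjoint (Finset.disjoint_of_subset_right hAM dKM2).symm]; omega
  · intro x hx y hy
    rcases Finset.mem_union.1 hx with hx | hx
    · exact h1 x hx y (hQM hy)
    · exact hBlt x hx y (Finset.sdiff_subset (hQ hy))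
  · intro x hx y hy
    rcases Finset.mem_union.1 hy with hy | hy
    · exact hAlt y hy x (hQ hx)
    · exact h2 y hy x (hQM hx)
  · intro x hx y hy
    rcases Finset.mem_union.1 hx with hx | hx <;> rcases Finset.mem_union.1 hy with hy | hy
    · exact h1 x hx y (hAM hy)
    · exact (h1 x hx y0 hy0).trans (h2 y hy y0 hy0)
    · exact hBlt x hx y (hA hy)
    · exact h2 y hy x (hB hx)
end
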